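/- arXiv:2204.10017 — 2 statements merged into one kernel-verified Lean document; each statement's English description precedes it below -/
import Mathlib

section
/- (Ingham's theorem on ℝ.) Let Θ be a nonnegative even function on ℝ which decreases to zero as y → ∞. Then the following are equivalent: (i) there exist a > 0, a constant C > 0, and a nonzero continuous function f on ℝ vanishing identically outside the interval (−a,a) whose Fourier transform satisfies |f̂(y)| ≤ C e^{−|y|Θ(y)} for all y ∈ ℝ; (ii) ∫₁^∞ Θ(t) t^{−1} dt < ∞. -/
open MeasureTheory Filter
open scoped ENNReal

noncomputable section


namespace InghamAux

/-- The Fourier-Laplace transform. -/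
def FL (f : ℝ → ℂ) (z : ℂ) : ℂ := ∫ x : ℝ, f x * Complex.exp (-Complex.I * (x : ℂ) * z)

lemma hasCompactSupport_of {f : ℝ → ℂ} {a : ℝ}
    (hs : ∀ x, x ∉ Set.Ioo (-a) a → f x = 0) : HasCompactSupport f := by
  apply HasCompactSupport.intro (isCompact_Icc (a := -a) (b := a))
  intro x hx
  exact hs x (fun h => hx (Set.Ioo_subset_Icc_self h))

lemma differentiable_FL {f : ℝ → ℂ} {a : ℝ} (ha : 0 < a) (hf : Continuous f)
    (hs : ∀ x, x ∉ Set.Ioo (-a) a → f x = 0) : Differentiable ℂ (FL f) := by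
  intro z₀
  have hc := hasCompactSupport_of hs
  have hmeas : ∀ z : ℂ, Continuous (fun x : ℝ => f x * Complex.exp (-Complex.I * (x : ℂ) * z)) := by
    intro z; fun_prop
  have hint : ∀ z : ℂ, Integrable (fun x : ℝ => f x * Complex.exp (-Complex.I * (x : ℂ) * z)) := by
    intro z
    exact (hmeas z).integrable_of_hasCompactSupport hc.mul_right
  have := hasDerivAt_integral_of_dominated_loc_of_deriv_le (𝕜 := ℂ) (μ := (volume : Measure ℝ))
    (F := fun (z : ℂ) (x : ℝ) => f x * Complex.exp (-Complex.I * (x : ℂ) * z))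
    (F' := fun (z : ℂ) (x : ℝ) => f x * (Complex.exp (-Complex.I * (x : ℂ) * z) *
      (-Complex.I * (x : ℂ))))
    (x₀ := z₀) (s := Metric.ball z₀ 1)
    (bound := fun x => ‖f x‖ * (Real.exp (a * (‖z₀‖ + 1)) * a))
    (Metric.ball_mem_nhds z₀ one_pos)
    (Eventually.of_forall fun z => (hmeas z).aestronglyMeasurable) (hint z₀)
    (by apply Continuous.aestronglyMeasurable; fun_prop) ?_ ?_ ?_
  · exact this.2.differentiableAt
  · refine Eventually.of_forall fun x z hz => ?_
    by_cases hx : x ∈ Set.Ioo (-a) a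
    · have hxa : |x| ≤ a := abs_le.2 ⟨hx.1.le, hx.2.le⟩
      have hzn : ‖z‖ ≤ ‖z₀‖ + 1 := by
        have h1 : ‖z - z₀‖ < 1 := by simpa [dist_eq_norm] using hz
        have h2 : ‖z‖ ≤ ‖z₀‖ + ‖z - z₀‖ := by
          calc ‖z‖ = ‖z₀ + (z - z₀)‖ := by ring_nf
            _ ≤ _ := norm_add_le _ _
        linarith
      rw [norm_mul, norm_mul]
      gcongr
      · refine (Complex.norm_exp_le_exp_norm _).trans ?_
        gcongr
        rw [norm_mul]
        gcongr
        simpa using hxa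
      · simpa using hxa
    · simp [hs x hx]
  · exact (hf.integrable_of_hasCompactSupport hc).norm.mul_const _
  · refine Eventually.of_forall fun x z hz => ?_
    apply HasDerivAt.const_mul
    have h := ((hasDerivAt_id z).const_mul (-Complex.I * (x : ℂ))).cexp
    simpa using h

lemma norm_exp_FL_le {f : ℝ → ℂ} {a : ℝ} (hf : Continuous f)
    (hs : ∀ x, x ∉ Set.Ioo (-a) a → f x = 0) (z : ℂ) (hz : 0 ≤ z.im) :
    ‖Complex.exp (Complex.I * a * z) * FL f z‖ ≤ ∫ x, ‖f x‖ := by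
  unfold FL
  rw [← integral_const_mul]
  refine norm_integral_le_of_norm_le
    ((hf.integrable_of_hasCompactSupport (hasCompactSupport_of hs)).norm) ?_
  refine Eventually.of_forall fun x => ?_
  by_cases hx : x ∈ Set.Ioo (-a) a
  · rw [norm_mul, norm_mul, Complex.norm_exp, Complex.norm_exp]
    have e1 : (Complex.I * a * z).re = - (a * z.im) := by simp
    have e2 : (-Complex.I * x * z).re = x * z.im := by simp
    rw [e1, e2, mul_left_comm, ← Real.exp_add]
    have : Real.exp (-(a * z.im) + x * z.im) ≤ 1 := by
      rw [Real.exp_le_one_iff]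
      nlinarith [hx.2]
    nlinarith [norm_nonneg (f x)]
  · simp [hs x hx]

lemma eq_zero_of_FL {f : ℝ → ℂ} {a : ℝ} (hf : Continuous f)
    (hs : ∀ x, x ∉ Set.Ioo (-a) a → f x = 0) (h0 : ∀ y : ℝ, FL f y = 0) : f = 0 := by
  have hi := hf.integrable_of_hasCompactSupport (hasCompactSupport_of hs) (μ := volume)
  have hF : FourierTransform.fourier f = (0 : ℝ → ℂ) := by
    funext y
    have := h0 (2 * Real.pi * y)
    rw [Real.fourier_real_eq_integral_exp_smul]
    unfold FL at this
    simp only [Pi.zero_apply]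
    rw [← this]
    congr 1
    funext x
    rw [smul_eq_mul, mul_comm]
    congr 2
    push_cast
    ring
  have := hf.fourierInv_fourier_eq hi (by rw [hF]; exact integrable_zero _ _ _)
  rw [← this, hF]
  funext y
  rw [Real.fourierInv_eq]
  simp

end InghamAux

namespace InghamAux

open Metric Real in
/-- Lower bound for circle averages coming from Jensen's formula. -/
lemma jensen_lower {h : ℂ → ℂ} (hh : AnalyticOnNhd ℂ h (ball 0 1)) (hne : ∃ x ∈ ball (0 : ℂ) 1, h x ≠ 0) :
    ∃ B : ℝ, ∀ r ∈ Set.Ico (1 / 2 : ℝ) 1, ∀ ε > (0 : ℝ),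
      -B ≤ ∫ θ in (0)..(2 * π), log (max ‖h (circleMap 0 r θ)‖ ε) := by
  set n : ℤ := (meromorphicOrderAt h 0).untop₀ with hn
  have hn0 : 0 ≤ n := by
    have := (hh 0 (by simp)).meromorphicOrderAt_nonneg
    rw [hn]
    exact WithTop.untop₀_nonneg.2 this
  refine ⟨2 * π * (n * log 2 - log ‖meromorphicTrailingCoeffAt h 0‖), ?_⟩
  intro r hr ε hε
  have hr0 : 0 < r := by linarith [hr.1]
  have habs : |r| = r := abs_of_pos hr0
  have hsub : closedBall (0 : ℂ) |r| ⊆ ball 0 1 := by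
    rw [habs]; exact closedBall_subset_ball hr.2
  have hA : AnalyticOnNhd ℂ h (closedBall 0 |r|) := hh.mono hsub
  have hJ := hA.meromorphicOn.circleAverage_log_norm hr0.ne'
  have h1 : 0 ≤ ∑ᶠ u, (MeromorphicOn.divisor h (closedBall 0 |r|) u : ℝ) *
      log (r * ‖(0 : ℂ) - u‖⁻¹) := by
    apply finsum_nonneg
    intro u
    by_cases hu : u ∈ closedBall (0 : ℂ) |r|
    · apply mul_nonneg
      · exact_mod_cast MeromorphicOn.AnalyticOnNhd.divisor_nonneg hA u
      · by_cases hu0 : u = 0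
        · simp [hu0]
        · apply log_nonneg
          rw [zero_sub, norm_neg, ← div_eq_mul_inv, one_le_div (norm_pos_iff.2 hu0)]
          simpa [habs] using hu
    · simp [hu]
  have h2 : MeromorphicOn.divisor h (closedBall 0 |r|) 0 = n := by
    rw [MeromorphicOn.divisor_apply hA.meromorphicOn (by simp)]
  have h3 : -(n * log 2 : ℝ) ≤ n * log r := by
    have : log (1 / 2) ≤ log r := log_le_log (by norm_num) hr.1
    rw [one_div, log_inv] at this
    have hn0' : (0 : ℝ) ≤ n := by exact_mod_cast hn0
    nlinarith
  have hco : Set.preimage h {0}ᶜ ∈ codiscreteWithin (sphere (0 : ℂ) |r|) := by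
    obtain ⟨x, hx, hx0⟩ := hne
    have h5 := hh.preimage_zero_mem_codiscreteWithin hx0 hx
      ((convex_ball (0 : ℂ) 1).isConnected ⟨0, by simp⟩)
    exact codiscreteWithin_mono (sphere_subset_closedBall.trans hsub) h5
  classical
  set L : ℂ → ℝ := fun w => if h w = 0 then log ε else log ‖h w‖ with hL
  have heq : (fun w => log ‖h w‖) =ᶠ[codiscreteWithin (sphere (0 : ℂ) |r|)] L := by
    filter_upwards [hco] with w hw
    have : h w ≠ 0 := hw
    simp [hL, this]
  have hLi : CircleIntegrable L 0 r :=
    CircleIntegrable.congr_codiscreteWithin heq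
      (hA.mono sphere_subset_closedBall).meromorphicOn.circleIntegrable_log_norm
  have hcont : Continuous fun θ => log (max ‖h (circleMap 0 r θ)‖ ε) := by
    apply Continuous.log
    · apply Continuous.max _ continuous_const
      apply Continuous.norm
      refine hA.continuousOn.comp_continuous (by fun_prop) ?_
      intro θ
      simp
    · intro θ
      exact (lt_of_lt_of_le hε (le_max_right _ _)).ne'
  have hmono : circleAverage L 0 r ≤ circleAverage (fun w => log (max ‖h w‖ ε)) 0 r := by
    apply circleAverage_mono hLi
    · exact hcont.intervalIntegrable _ _
    · intro w hw
      simp only [hL]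
      split_ifs with h0
      · exact log_le_log hε (le_max_right _ _)
      · exact log_le_log (norm_pos_iff.2 h0) (le_max_left _ _)
  rw [← circleAverage_congr_codiscreteWithin heq hr0.ne', hJ, h2] at hmono
  rw [circleAverage_def, smul_eq_mul] at hmono
  have h6 : -(n * log 2 : ℝ) + log ‖meromorphicTrailingCoeffAt h 0‖ ≤
    (2 * π)⁻¹ * ∫ θ in (0)..(2 * π), log (max ‖h (circleMap 0 r θ)‖ ε) := by linarith
  have h7 := mul_le_mul_of_nonneg_left h6 (by positivity : (0 : ℝ) ≤ 2 * π)
  rw [mul_inv_cancel_left₀ (by positivity)] at h7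
  linarith

open Metric Real in
lemma jensen_boundary {h : ℂ → ℂ} (hh : AnalyticOnNhd ℂ h (ball 0 1)) (hne : ∃ x ∈ ball (0 : ℂ) 1, h x ≠ 0) {M : ℝ} (hM : ∀ w ∈ ball (0 : ℂ) 1, ‖h w‖ ≤ M)
    {k : ℝ → ℂ} (hk : ∀ θ ∈ Set.Ioo 0 π, Tendsto (fun r => h (circleMap 0 r θ))
      (nhdsWithin 1 (Set.Iio 1)) (nhds (k θ))) :
    ∃ B : ℝ, ∀ ε ∈ Set.Ioo (0 : ℝ) 1,
      -B ≤ ∫ θ in (0)..π, log (max ‖k θ‖ ε) := by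
  obtain ⟨B, hB⟩ := jensen_lower hh hne
  refine ⟨B + π * log (max M 1), ?_⟩
  intro ε hε
  set M' := max M 1 with hM'
  have hM1 : 1 ≤ M' := le_max_right _ _
  have hball : ∀ r ∈ Set.Ico (1 / 2 : ℝ) 1, ∀ θ, circleMap 0 r θ ∈ ball (0 : ℂ) 1 := by
    intro r hr θ
    have : 0 < r := by linarith [hr.1]
    simp [abs_of_pos this, hr.2]
  have hcont : ∀ r ∈ Set.Ico (1 / 2 : ℝ) 1,
      Continuous fun θ => log (max ‖h (circleMap 0 r θ)‖ ε) := by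
    intro r hr
    apply Continuous.log
    · apply Continuous.max _ continuous_const
      apply Continuous.norm
      exact hh.continuousOn.comp_continuous (by fun_prop) (hball r hr)
    · intro θ
      exact (lt_of_lt_of_le hε.1 (le_max_right _ _)).ne'
  have hup : ∀ r ∈ Set.Ico (1 / 2 : ℝ) 1, ∀ θ, log (max ‖h (circleMap 0 r θ)‖ ε) ≤ log M' := by
    intro r hr θ
    apply log_le_log (lt_of_lt_of_le hε.1 (le_max_right _ _))
    exact max_le ((hM _ (hball r hr θ)).trans (le_max_left _ _)) (hε.2.le.trans hM1)
  have hlo : ∀ r θ, log ε ≤ log (max ‖h (circleMap 0 r θ)‖ ε) := by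
    intro r θ
    exact log_le_log hε.1 (le_max_right _ _)
  have hstep : ∀ r ∈ Set.Ico (1 / 2 : ℝ) 1,
      -(B + π * log M') ≤ ∫ θ in (0)..π, log (max ‖h (circleMap 0 r θ)‖ ε) := by
    intro r hr
    have h1 := hB r hr ε hε.1
    rw [← intervalIntegral.integral_add_adjacent_intervals (b := π)
      ((hcont r hr).intervalIntegrable _ _) ((hcont r hr).intervalIntegrable _ _)] at h1
    have h2 : ∫ θ in π..(2 * π), log (max ‖h (circleMap 0 r θ)‖ ε) ≤ ∫ θ in π..(2 * π), log M' := by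
      apply intervalIntegral.integral_mono_on (by linarith [pi_pos])
        ((hcont r hr).intervalIntegrable _ _) (by simp)
      intro θ _
      exact hup r hr θ
    rw [intervalIntegral.integral_const, smul_eq_mul] at h2
    linarith
  have hmem : ∀ᶠ r in nhdsWithin (1 : ℝ) (Set.Iio 1), r ∈ Set.Ico (1 / 2 : ℝ) 1 := by
    have : Set.Ico (1 / 2 : ℝ) 1 ∈ nhdsWithin (1 : ℝ) (Set.Iio 1) :=
      Ico_mem_nhdsLT (by norm_num)
    exact this
  have hlim : Tendsto (fun r => ∫ θ in (0)..π, log (max ‖h (circleMap 0 r θ)‖ ε))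
      (nhdsWithin 1 (Set.Iio 1)) (nhds (∫ θ in (0)..π, log (max ‖k θ‖ ε))) := by
    apply intervalIntegral.tendsto_integral_filter_of_dominated_convergence
      (fun _ => |log ε| + |log M'|)
    · filter_upwards [hmem] with r hr
      exact (hcont r hr).aestronglyMeasurable
    · filter_upwards [hmem] with r hr
      refine Eventually.of_forall fun θ _ => ?_
      rw [norm_eq_abs, abs_le]
      constructor
      · linarith [hlo r θ, neg_abs_le (log ε), abs_nonneg (log M')]
      · linarith [hup r hr θ, le_abs_self (log M'), abs_nonneg (log ε)]
    · simp
    · have : ∀ᵐ θ : ℝ, θ ≠ π := by simp [ae_iff]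
      filter_upwards [this] with θ hθ hmem'
      rw [Set.uIoc_of_le pi_pos.le] at hmem'
      have h3 := hk θ ⟨hmem'.1, lt_of_le_of_ne hmem'.2 hθ⟩
      refine Tendsto.log (h3.norm.max tendsto_const_nhds) ?_
      exact (lt_of_lt_of_le hε.1 (le_max_right _ _)).ne'
  refine ge_of_tendsto hlim ?_
  filter_upwards [hmem] with r hr
  exact hstep r hr

end InghamAux

namespace InghamAux

/-- The Cayley transform from the disc to the upper half plane. -/
def cay (w : ℂ) : ℂ := Complex.I * (1 - w) / (1 + w)

lemma one_add_ne {w : ℂ} (hw : w ∈ Metric.ball (0 : ℂ) 1) : 1 + w ≠ 0 := by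
  intro h
  have : w = -1 := by linear_combination h
  rw [this] at hw
  simp at hw

lemma cay_im {w : ℂ} (hw : w ∈ Metric.ball (0 : ℂ) 1) : 0 ≤ (cay w).im := by
  have hn : Complex.normSq w ≤ 1 := by
    rw [Complex.normSq_eq_norm_sq]
    have : ‖w‖ < 1 := by simpa using hw
    nlinarith [norm_nonneg w]
  have : (cay w).im = (1 - Complex.normSq w) / Complex.normSq (1 + w) := by
    simp only [cay, Complex.div_im, Complex.normSq_apply]
    simp
    ring
  rw [this]
  exact div_nonneg (by linarith) (Complex.normSq_nonneg _)

lemma cay_surj {z : ℂ} (hz : 0 < z.im) : ∃ w ∈ Metric.ball (0 : ℂ) 1, cay w = z := by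
  have hz1 : Complex.I + z ≠ 0 := by
    intro h
    have := congrArg Complex.im h
    simp at this
    linarith
  refine ⟨(Complex.I - z) / (Complex.I + z), ?_, ?_⟩
  · rw [mem_ball_zero_iff, norm_div, div_lt_one (norm_pos_iff.2 hz1)]
    rw [← sq_lt_sq₀ (norm_nonneg _) (norm_nonneg _), ← Complex.normSq_eq_norm_sq,
      ← Complex.normSq_eq_norm_sq, Complex.normSq_apply, Complex.normSq_apply]
    simp
    nlinarith
  · unfold cay
    have h1 : 1 + (Complex.I - z) / (Complex.I + z) = 2 * Complex.I / (Complex.I + z) := by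
      field_simp; ring
    have h2 : 1 - (Complex.I - z) / (Complex.I + z) = 2 * z / (Complex.I + z) := by
      field_simp; ring
    rw [h1, h2]
    field_simp

lemma cos_half_pos {θ : ℝ} (hθ : θ ∈ Set.Ioo 0 Real.pi) : 0 < Real.cos (θ / 2) :=
  Real.cos_pos_of_mem_Ioo ⟨by linarith [hθ.1, Real.pi_pos], by linarith [hθ.2]⟩

lemma circle_eq (θ : ℝ) : circleMap 0 1 θ =
    (Real.cos (θ / 2) + Real.sin (θ / 2) * Complex.I) ^ 2 := by
  have : Complex.exp (θ * Complex.I) = Complex.exp ((θ / 2 : ℝ) * Complex.I) ^ 2 := by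
    rw [← Complex.exp_nat_mul]
    congr 1
    push_cast
    ring
  simp only [circleMap, Complex.ofReal_one, one_mul, zero_add, this]
  rw [Complex.exp_mul_I, ← Complex.ofReal_cos, ← Complex.ofReal_sin]

lemma one_add_circle {θ : ℝ} : 1 + circleMap 0 1 θ =
    2 * Real.cos (θ / 2) * (Real.cos (θ / 2) + Real.sin (θ / 2) * Complex.I) := by
  rw [circle_eq]
  have h : (Real.sin (θ / 2) : ℂ) ^ 2 + (Real.cos (θ / 2) : ℂ) ^ 2 = 1 := by
    exact_mod_cast Real.sin_sq_add_cos_sq (θ / 2)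
  linear_combination -h + (Real.sin (θ / 2) : ℂ) ^ 2 * Complex.I_sq

lemma one_sub_circle {θ : ℝ} : 1 - circleMap 0 1 θ =
    -2 * Complex.I * Real.sin (θ / 2) * (Real.cos (θ / 2) + Real.sin (θ / 2) * Complex.I) := by
  rw [circle_eq]
  have h : (Real.sin (θ / 2) : ℂ) ^ 2 + (Real.cos (θ / 2) : ℂ) ^ 2 = 1 := by
    exact_mod_cast Real.sin_sq_add_cos_sq (θ / 2)
  linear_combination -h + (Real.sin (θ / 2) : ℂ) ^ 2 * Complex.I_sq

lemma cs_ne (θ : ℝ) : (Real.cos θ + Real.sin θ * Complex.I : ℂ) ≠ 0 := by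
  rw [Complex.ofReal_cos, Complex.ofReal_sin, ← Complex.exp_mul_I]
  exact Complex.exp_ne_zero _

lemma cay_circle {θ : ℝ} (hθ : θ ∈ Set.Ioo 0 Real.pi) :
    cay (circleMap 0 1 θ) = (Real.tan (θ / 2) : ℝ) := by
  unfold cay
  rw [one_add_circle, one_sub_circle, Real.tan_eq_sin_div_cos, Complex.ofReal_div]
  have h1 := cs_ne (θ / 2)
  have h2 : (Real.cos (θ / 2) : ℂ) ≠ 0 := by exact_mod_cast (cos_half_pos hθ).ne'
  rw [div_eq_div_iff (mul_ne_zero (mul_ne_zero two_ne_zero h2) h1) h2]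
  linear_combination -2 * (Real.cos (θ / 2) : ℂ) * Real.sin (θ / 2) *
    (Real.cos (θ / 2) + Real.sin (θ / 2) * Complex.I) * Complex.I_sq

lemma log_lower {f : ℝ → ℂ} {a : ℝ} (ha : 0 < a) (hf : Continuous f)
    (hs : ∀ x, x ∉ Set.Ioo (-a) a → f x = 0) (hne : f ≠ 0) :
    ∃ B : ℝ, ∀ ε ∈ Set.Ioo (0 : ℝ) 1,
      -B ≤ ∫ θ in (0)..Real.pi, Real.log (max ‖FL f (Real.tan (θ / 2) : ℝ)‖ ε) := by
  have hd := differentiable_FL ha hf hs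
  set G : ℂ → ℂ := fun z => Complex.exp (Complex.I * a * z) * FL f z with hG
  have hGd : Differentiable ℂ G := by
    have : Differentiable ℂ (fun z : ℂ => Complex.exp (Complex.I * a * z)) := by fun_prop
    exact this.mul hd
  have hcayd : ∀ w, 1 + w ≠ 0 → DifferentiableAt ℂ cay w := by
    intro w hw
    unfold cay
    fun_prop (disch := exact hw)
  have hk : ∀ y : ℝ, ‖G y‖ = ‖FL f y‖ := by
    intro y
    rw [hG]
    simp only [norm_mul, Complex.norm_exp]
    simp
  have hJ := jensen_boundary (h := fun w => G (cay w)) (M := ∫ x, ‖f x‖)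
    (k := fun θ => G (Real.tan (θ / 2) : ℝ))
  simp only [hk] at hJ
  apply hJ
  · apply DifferentiableOn.analyticOnNhd _ Metric.isOpen_ball
    intro w hw
    exact ((hGd _).comp w (hcayd w (one_add_ne hw))).differentiableWithinAt
  · by_contra! hcon
    apply hne
    refine eq_zero_of_FL hf hs ?_
    have hA : AnalyticOnNhd ℂ (FL f) Set.univ := fun z _ => hd.analyticAt z
    have h0 : FL f =ᶠ[nhds Complex.I] 0 := by
      have : {z : ℂ | 0 < z.im} ∈ nhds Complex.I :=
        (isOpen_lt continuous_const Complex.continuous_im).mem_nhds (by simp)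
      filter_upwards [this] with z hz
      obtain ⟨w, hw, hwz⟩ := cay_surj hz
      have h1 := hcon w hw
      rw [hwz] at h1
      simpa [hG] using h1
    have := hA.eqOn_zero_of_preconnected_of_eventuallyEq_zero isPreconnected_univ
      (Set.mem_univ Complex.I) h0
    intro y
    exact this (Set.mem_univ (y : ℂ))
  · intro w hw
    exact norm_exp_FL_le hf hs _ (cay_im hw)
  · intro θ hθ
    have h2 : 1 + circleMap 0 1 θ ≠ 0 := by
      rw [one_add_circle]
      have : (Real.cos (θ / 2) : ℂ) ≠ 0 := by exact_mod_cast (cos_half_pos hθ).ne'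
      exact mul_ne_zero (mul_ne_zero two_ne_zero this) (cs_ne _)
    have h1 : ContinuousAt (fun r : ℝ => G (cay (circleMap 0 r θ))) 1 := by
      have e1 : ContinuousAt (fun r : ℝ => circleMap 0 r θ) 1 := by
        unfold circleMap; fun_prop
      have e2 : ContinuousAt (fun w => G (cay w)) (circleMap 0 1 θ) :=
        ContinuousAt.comp (hGd.continuous.continuousAt) (hcayd _ h2).continuousAt
      exact ContinuousAt.comp (f := fun r : ℝ => circleMap 0 r θ) (x := 1) e2 e1
    have h3 := h1.tendsto
    rw [cay_circle hθ] at h3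
    exact h3.mono_left nhdsWithin_le_nhds

end InghamAux

namespace InghamAux

lemma image_arctan {R : ℝ} :
    Set.image (fun y => 2 * Real.arctan y) (Set.Icc 1 R) ⊆ Set.Ioo 0 Real.pi := by
  rintro _ ⟨y, hy, rfl⟩
  have h1 : 0 < Real.arctan y := Real.arctan_pos.2 (by linarith [hy.1])
  have h2 := Real.arctan_lt_pi_div_two y
  exact ⟨show 0 < 2 * Real.arctan y by linarith, show 2 * Real.arctan y < Real.pi by linarith⟩

lemma forward {Θ : ℝ → ℝ} (hΘnonneg : ∀ y, 0 ≤ Θ y)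
    (hΘdec : AntitoneOn Θ (Set.Ici 0)) {a C : ℝ} (ha : 0 < a) (hC : 0 < C) {f : ℝ → ℂ}
    (hf : Continuous f) (hne : f ≠ 0) (hs : ∀ x, x ∉ Set.Ioo (-a) a → f x = 0)
    (hb : ∀ y : ℝ, ‖FL f y‖ ≤ C * Real.exp (-|y| * Θ y)) :
    IntegrableOn (fun t => Θ t / t) (Set.Ici 1) volume := by
  obtain ⟨B, hB⟩ := log_lower ha hf hs hne
  have hpi := Real.pi_pos
  have hΘint : ∀ R, IntegrableOn Θ (Set.Icc 1 R) volume := by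
    intro R
    apply AntitoneOn.integrableOn_isCompact isCompact_Icc
    exact hΘdec.mono (fun x hx => by have := hx.1; simp; linarith)
  have hcont1 : ∀ R : ℝ, ContinuousOn (fun y : ℝ => 2 / (1 + y ^ 2) * y) (Set.Icc 1 R) := by
    intro R
    apply Continuous.continuousOn
    have : ∀ y : ℝ, 1 + y ^ 2 ≠ 0 := fun y => by positivity
    fun_prop (disch := exact this _)
  have hint1 : ∀ R, IntegrableOn (fun y => 2 / (1 + y ^ 2) * y * Θ y) (Set.Icc 1 R) volume :=
    fun R => (hΘint R).continuousOn_mul (hcont1 R) isCompact_Icc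
  have hint2 : ∀ R, IntegrableOn (fun y => Θ y / y) (Set.Icc 1 R) volume := by
    intro R
    have h1 : ContinuousOn (fun y : ℝ => y⁻¹) (Set.Icc 1 R) :=
      continuousOn_id.inv₀ (fun y hy => by have := hy.1; simp; linarith)
    have := (hΘint R).mul_continuousOn h1 isCompact_Icc
    simpa [div_eq_mul_inv] using this
  have key : ∀ R, 1 ≤ R → ∫ y in Set.Icc 1 R, 2 / (1 + y ^ 2) * y * Θ y ≤
      B + Real.pi * Real.log C := by
    intro R hR
    set g : ℝ → ℝ := fun θ => Real.tan (θ / 2) * Θ (Real.tan (θ / 2)) with hg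
    set E := Set.image (fun y => 2 * Real.arctan y) (Set.Icc 1 R) with hE
    have hEmeas : MeasurableSet E := by
      apply IsCompact.measurableSet
      exact isCompact_Icc.image (by fun_prop)
    have hder : ∀ y ∈ Set.Icc 1 R, HasDerivWithinAt (fun y => 2 * Real.arctan y)
        (2 * (1 / (1 + y ^ 2))) (Set.Icc 1 R) y := fun y _ =>
      ((Real.hasDerivAt_arctan y).const_mul 2).hasDerivWithinAt
    have hinj : Set.InjOn (fun y => 2 * Real.arctan y) (Set.Icc 1 R) := by
      intro x _ y _ hxy
      exact Real.arctan_injective (by simpa using hxy)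
    have hpt : ∀ y : ℝ, |2 * (1 / (1 + y ^ 2))| • g (2 * Real.arctan y) =
        2 / (1 + y ^ 2) * y * Θ y := by
      intro y
      rw [abs_of_nonneg (by positivity)]
      simp only [hg, smul_eq_mul]
      rw [mul_div_cancel_left₀ _ two_ne_zero, Real.tan_arctan]
      ring
    have hgE : IntegrableOn g E := by
      rw [hE, integrableOn_image_iff_integrableOn_abs_deriv_smul measurableSet_Icc hder hinj]
      simp only [hpt]
      exact hint1 R
    have hgI : ∫ θ in E, g θ = ∫ y in Set.Icc 1 R, 2 / (1 + y ^ 2) * y * Θ y := by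
      rw [hE, integral_image_eq_integral_abs_deriv_smul measurableSet_Icc hder hinj]
      simp only [hpt]
    rw [← hgI]
    set ε : ℝ := min (C * Real.exp (-(R * Θ 0))) (1 / 2) with hε
    have hε0 : 0 < ε := lt_min (by positivity) (by norm_num)
    have hεC : ε ≤ C * Real.exp (-(R * Θ 0)) := min_le_left _ _
    have hB' := hB ε ⟨hε0, lt_of_le_of_lt (min_le_right _ _) (by norm_num)⟩
    have hRΘ : 0 ≤ R * Θ 0 := mul_nonneg (by linarith) (hΘnonneg 0)
    have htanpos : ∀ θ ∈ Set.Ioc 0 Real.pi, 0 ≤ Real.tan (θ / 2) := by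
      intro θ hθ
      apply Real.tan_nonneg_of_nonneg_of_le_pi_div_two <;> linarith [hθ.1, hθ.2]
    have hpoint : ∀ θ ∈ Set.Ioc 0 Real.pi,
        Real.log (max ‖FL f (Real.tan (θ / 2) : ℝ)‖ ε) ≤ Real.log C - E.indicator g θ := by
      intro θ hθ
      have ht := htanpos θ hθ
      have hpos : 0 < max ‖FL f (Real.tan (θ / 2) : ℝ)‖ ε := lt_of_lt_of_le hε0 (le_max_right _ _)
      have hfb := hb (Real.tan (θ / 2))
      rw [abs_of_nonneg ht] at hfb
      by_cases hθE : θ ∈ E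
      · rw [Set.indicator_of_mem hθE]
        obtain ⟨y, hy, hyθ⟩ := hθE
        have hty : Real.tan (θ / 2) = y := by
          rw [← hyθ]
          simp [Real.tan_arctan]
        have hgθ : g θ = y * Θ y := by simp only [hg, hty]
        have hle : y * Θ y ≤ R * Θ 0 := by
          have := hΘdec (Set.self_mem_Ici) (show y ∈ Set.Ici (0 : ℝ) by
            have := hy.1; simp; linarith) (by linarith [hy.1])
          exact mul_le_mul hy.2 this (hΘnonneg y) (by linarith)
        have hmx : max ‖FL f (Real.tan (θ / 2) : ℝ)‖ ε ≤ C * Real.exp (-(y * Θ y)) := by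
          apply max_le
          · rw [hty] at hfb ⊢
            rwa [neg_mul] at hfb
          · refine hεC.trans ?_
            gcongr
        calc _ ≤ Real.log (C * Real.exp (-(y * Θ y))) := Real.log_le_log hpos hmx
          _ = _ := by
            rw [Real.log_mul hC.ne' (Real.exp_ne_zero _), Real.log_exp, hgθ]; ring
      · rw [Set.indicator_of_notMem hθE, sub_zero]
        apply Real.log_le_log hpos
        apply max_le
        · refine hfb.trans ?_
          have : Real.exp (-Real.tan (θ / 2) * Θ (Real.tan (θ / 2))) ≤ 1 := by
            rw [Real.exp_le_one_iff]
            nlinarith [mul_nonneg ht (hΘnonneg (Real.tan (θ / 2)))]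
          nlinarith
        · refine hεC.trans ?_
          have : Real.exp (-(R * Θ 0)) ≤ 1 := by
            rw [Real.exp_le_one_iff]; linarith
          nlinarith
    have hsub : E ⊆ Set.Ioc 0 Real.pi := image_arctan.trans Set.Ioo_subset_Ioc_self
    have hindI : Integrable (E.indicator g) := hgE.integrable_indicator hEmeas
    have hrhs : IntegrableOn (fun θ => Real.log C - E.indicator g θ) (Set.Ioc 0 Real.pi) :=
      Integrable.sub (by simp) hindI.integrableOn
    rw [intervalIntegral.integral_of_le hpi.le] at hB'
    have hlhs : IntegrableOn (fun θ => Real.log (max ‖FL f (Real.tan (θ / 2) : ℝ)‖ ε))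
        (Set.Ioc 0 Real.pi) := by
      have hmeas : Measurable (fun θ : ℝ => Real.log (max ‖FL f (Real.tan (θ / 2) : ℝ)‖ ε)) := by
        have h1 : Measurable (FL f) := (differentiable_FL ha hf hs).continuous.measurable
        have h2 : Measurable Real.tan := by
          have : Real.tan = fun x => Real.sin x / Real.cos x := by
            funext x; exact Real.tan_eq_sin_div_cos x
          rw [this]
          exact Real.measurable_sin.div Real.measurable_cos
        have h3 : Measurable (fun θ : ℝ => FL f (Real.tan (θ / 2) : ℝ)) :=
          h1.comp (Complex.measurable_ofReal.comp (h2.comp (measurable_id.div_const 2)))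
        exact Real.measurable_log.comp (h3.norm.max measurable_const)
      refine Measure.integrableOn_of_bounded (M := |Real.log ε| + |Real.log (max C ε)|) (by simp)
        hmeas.aestronglyMeasurable ?_
      refine Eventually.of_forall fun θ => ?_
      rw [Real.norm_eq_abs, abs_le]
      have e1 : Real.log ε ≤ Real.log (max ‖FL f (Real.tan (θ / 2) : ℝ)‖ ε) :=
        Real.log_le_log hε0 (le_max_right _ _)
      have e2 : Real.log (max ‖FL f (Real.tan (θ / 2) : ℝ)‖ ε) ≤ Real.log (max C ε) := by
        apply Real.log_le_log (lt_of_lt_of_le hε0 (le_max_right _ _))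
        apply max_le_max_right
        refine (hb _).trans ?_
        have : Real.exp (-|Real.tan (θ / 2)| * Θ (Real.tan (θ / 2))) ≤ 1 := by
          rw [Real.exp_le_one_iff]
          nlinarith [mul_nonneg (abs_nonneg (Real.tan (θ / 2))) (hΘnonneg (Real.tan (θ / 2)))]
        nlinarith
      constructor
      · linarith [neg_abs_le (Real.log ε), abs_nonneg (Real.log (max C ε))]
      · linarith [le_abs_self (Real.log (max C ε)), abs_nonneg (Real.log ε)]
    have hI := setIntegral_mono_on hlhs hrhs measurableSet_Ioc hpoint
    rw [integral_sub (by simp) hindI.integrableOn, setIntegral_indicator hEmeas,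
      Set.inter_eq_right.2 hsub] at hI
    simp only [integral_const, smul_eq_mul, MeasurableSet.univ, measureReal_restrict_apply,
      Set.univ_inter, Real.volume_real_Ioc_of_le hpi.le, sub_zero] at hI
    linarith
  rw [integrableOn_Ici_iff_integrableOn_Ioi]
  refine integrableOn_Ioi_of_intervalIntegral_norm_bounded (l := atTop) (b := fun R : ℝ => R)
    (B + Real.pi * Real.log C) 1 ?_ tendsto_id ?_
  · intro R
    exact (hint2 R).mono_set Set.Ioc_subset_Icc_self
  · filter_upwards [eventually_ge_atTop 1] with R hR
    refine le_trans ?_ (key R hR)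
    rw [intervalIntegral.integral_of_le hR, integral_Icc_eq_integral_Ioc]
    refine setIntegral_mono_on ((hint2 R).mono_set Set.Ioc_subset_Icc_self).norm
      ((hint1 R).mono_set Set.Ioc_subset_Icc_self) measurableSet_Ioc ?_
    intro y hy
    have hy1 : 1 < y := hy.1
    have hy0 : 0 < y := by linarith
    rw [Real.norm_eq_abs, abs_of_nonneg (div_nonneg (hΘnonneg y) hy0.le), div_eq_inv_mul]
    apply mul_le_mul_of_nonneg_right _ (hΘnonneg y)
    rw [div_mul_eq_mul_div, le_div_iff₀ (by positivity), inv_mul_le_iff₀ hy0]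
    nlinarith

end InghamAux

namespace InghamAux

/-- Averaging operator. -/
def Av (ρ : ℝ) (F : ℝ → ℂ) (x : ℝ) : ℂ := ∫ t in (0 : ℝ)..1, F (x - ρ * t)

/-- Multiplier of the averaging operator. -/
def mul (s : ℝ) : ℂ := ∫ t in (0 : ℝ)..1, Complex.exp (-Complex.I * s * t)

lemma norm_mul_le_one (s : ℝ) : ‖mul s‖ ≤ 1 := by
  have := intervalIntegral.norm_integral_le_of_norm_le_const (a := (0 : ℝ)) (b := 1) (C := 1)
    (f := fun t : ℝ => Complex.exp (-Complex.I * s * t)) (by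
      intro t _
      rw [Complex.norm_exp]
      simp)
  simpa [mul] using this

lemma mul_zero_eq : mul 0 = 1 := by simp [mul]

lemma norm_mul_le (s : ℝ) (hs : s ≠ 0) : ‖mul s‖ ≤ 2 / |s| := by
  have hc : (-Complex.I * s : ℂ) ≠ 0 := by simp [hs]
  have : mul s = (Complex.exp (-Complex.I * s * (1 : ℝ)) -
      Complex.exp (-Complex.I * s * (0 : ℝ))) / (-Complex.I * s) :=
    integral_exp_mul_complex hc
  rw [this, norm_div]
  have h1 : ‖(-Complex.I * s : ℂ)‖ = |s| := by simp
  rw [h1]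
  gcongr
  refine (norm_sub_le _ _).trans ?_
  rw [Complex.norm_exp, Complex.norm_exp]
  simp
  norm_num

/-- Lipschitz functions bounded by one supported in an interval. -/
structure Good (b : ℝ) (F : ℝ → ℂ) : Prop where
  lip : ∀ x y, ‖F x - F y‖ ≤ |x - y|
  bdd : ∀ x, ‖F x‖ ≤ 1
  supp : ∀ x, b ≤ |x| → F x = 0

lemma Good.cont {b : ℝ} {F : ℝ → ℂ} (h : Good b F) : Continuous F := by
  have : LipschitzWith 1 F := LipschitzWith.of_dist_le_mul (by
    intro x y
    simpa [dist_eq_norm] using h.lip x y)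
  exact this.continuous

lemma Good.zero {b : ℝ} {F : ℝ → ℂ} (h : Good b F) : ∀ x, x ∉ Set.Ioo (-b) b → F x = 0 := by
  intro x hx
  apply h.supp
  by_contra! hlt
  exact hx (abs_lt.1 hlt)

lemma Good.av {b ρ : ℝ} {F : ℝ → ℂ} (h : Good b F) (hρ : 0 ≤ ρ) : Good (b + ρ) (Av ρ F) := by
  have hc := h.cont
  refine ⟨?_, ?_, ?_⟩
  · intro x y
    unfold Av
    rw [← intervalIntegral.integral_sub
      (Continuous.intervalIntegrable (by fun_prop) _ _)
      (Continuous.intervalIntegrable (by fun_prop) _ _)]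
    have := intervalIntegral.norm_integral_le_of_norm_le_const (a := (0 : ℝ)) (b := 1)
      (C := |x - y|) (f := fun t : ℝ => F (x - ρ * t) - F (y - ρ * t)) (by
        intro t _
        refine (h.lip _ _).trans (le_of_eq ?_)
        congr 1
        ring)
    simpa using this
  · intro x
    have := intervalIntegral.norm_integral_le_of_norm_le_const (a := (0 : ℝ)) (b := 1)
      (C := 1) (f := fun t : ℝ => F (x - ρ * t)) (fun t _ => h.bdd _)
    simpa [Av] using this
  · intro x hx
    unfold Av
    rw [intervalIntegral.integral_congr (g := fun _ => 0)]
    · simp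
    · intro t ht
      rw [Set.uIcc_of_le zero_le_one] at ht
      apply h.supp
      have h1 : |x| ≤ |x - ρ * t| + |ρ * t| := by
        calc |x| = |(x - ρ * t) + ρ * t| := by ring_nf
          _ ≤ _ := abs_add_le _ _
      have h2 : |ρ * t| ≤ ρ := by
        rw [abs_of_nonneg (mul_nonneg hρ ht.1)]
        nlinarith [ht.2]
      linarith

lemma Good.av_sub {b ρ : ℝ} {F : ℝ → ℂ} (h : Good b F) (hρ : 0 ≤ ρ) (x : ℝ) :
    ‖F x - Av ρ F x‖ ≤ ρ := by
  have hc := h.cont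
  have e : F x - Av ρ F x = ∫ t in (0 : ℝ)..1, (F x - F (x - ρ * t)) := by
    rw [intervalIntegral.integral_sub (by simp) (Continuous.intervalIntegrable (by fun_prop) _ _)]
    simp [Av]
  rw [e]
  have := intervalIntegral.norm_integral_le_of_norm_le_const (a := (0 : ℝ)) (b := 1)
    (C := ρ) (f := fun t : ℝ => F x - F (x - ρ * t)) (by
      intro t ht
      rw [Set.uIoc_of_le zero_le_one] at ht
      refine (h.lip _ _).trans ?_
      rw [sub_sub_cancel, abs_of_nonneg (mul_nonneg hρ ht.1.le)]
      nlinarith [ht.2])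
  simpa using this

lemma Good.FL_av {b ρ : ℝ} {F : ℝ → ℂ} (h : Good b F) (hρ : 0 ≤ ρ) (y : ℝ) :
    FL (Av ρ F) y = FL F y * mul (ρ * y) := by
  have hc := h.cont
  unfold FL
  have e1 : ∀ x : ℝ, Av ρ F x * Complex.exp (-Complex.I * (x : ℂ) * y) =
      ∫ t in Set.Ioc (0 : ℝ) 1, F (x - ρ * t) * Complex.exp (-Complex.I * (x : ℂ) * y) := by
    intro x
    rw [Av, intervalIntegral.integral_of_le zero_le_one, integral_mul_const]
  simp only [e1]
  have hcp : Continuous (fun p : ℝ × ℝ => F (p.1 - ρ * p.2) *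
      Complex.exp (-Complex.I * (p.1 : ℂ) * y)) := by fun_prop
  rw [integral_integral_swap]
  · have e2 : ∀ t : ℝ, ∫ x : ℝ, F (x - ρ * t) * Complex.exp (-Complex.I * (x : ℂ) * y) =
        (∫ x : ℝ, F x * Complex.exp (-Complex.I * (x : ℂ) * y)) *
          Complex.exp (-Complex.I * ((ρ * y : ℝ) : ℂ) * t) := by
      intro t
      rw [← integral_mul_const, ← integral_sub_right_eq_self (μ := volume)
        (fun x : ℝ => F x * Complex.exp (-Complex.I * (x : ℂ) * y) *
          Complex.exp (-Complex.I * ((ρ * y : ℝ) : ℂ) * t)) (ρ * t)]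
      congr 1
      funext x
      rw [mul_assoc (F (x - ρ * t)), ← Complex.exp_add]
      congr 2
      push_cast
      ring
    simp only [e2]
    rw [integral_const_mul, mul, intervalIntegral.integral_of_le zero_le_one]
  · have hind : ∀ p ∈ (Set.univ : Set ℝ) ×ˢ Set.Ioc (0 : ℝ) 1, p ∉ Set.Icc (-(b + ρ)) (b + ρ) ×ˢ Set.Icc (0 : ℝ) 1 →
        F (p.1 - ρ * p.2) * Complex.exp (-Complex.I * (p.1 : ℂ) * y) = 0 := by
      rintro ⟨x, t⟩ ⟨_, ht⟩ hp
      have ht : 0 < t ∧ t ≤ 1 := ht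
      have : F (x - ρ * t) = 0 := by
        apply h.supp
        by_contra! hlt
        apply hp
        rw [abs_lt] at hlt
        have h1 : 0 ≤ ρ * t := mul_nonneg hρ ht.1.le
        have h2 : ρ * t ≤ ρ := by nlinarith [ht.2]
        refine ⟨⟨?_, ?_⟩, ht.1.le, ht.2⟩ <;> simp <;> linarith [hlt.1, hlt.2]
      simp [this]
    have hI : IntegrableOn (fun p : ℝ × ℝ => F (p.1 - ρ * p.2) *
        Complex.exp (-Complex.I * (p.1 : ℂ) * y)) (Set.Icc (-(b + ρ)) (b + ρ) ×ˢ Set.Icc (0 : ℝ) 1)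
        (volume.prod volume) :=
      hcp.continuousOn.integrableOn_compact (isCompact_Icc.prod isCompact_Icc)
    have hI2 : IntegrableOn (fun p : ℝ × ℝ => F (p.1 - ρ * p.2) *
        Complex.exp (-Complex.I * (p.1 : ℂ) * y)) ((Set.univ : Set ℝ) ×ˢ Set.Ioc (0 : ℝ) 1)
        (volume.prod volume) :=
      hI.of_forall_sdiff_eq_zero (MeasurableSet.univ.prod measurableSet_Ioc)
        (fun p hp => hind p hp.1 hp.2)
    rw [IntegrableOn, ← Measure.prod_restrict, Measure.restrict_univ] at hI2
    exact hI2

/-- The initial hat function. -/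
def hat (x : ℝ) : ℂ := ((max 0 (1 - |x|) : ℝ) : ℂ)

lemma good_hat : Good 1 hat := by
  refine ⟨?_, ?_, ?_⟩
  · intro x y
    unfold hat
    rw [← Complex.ofReal_sub, Complex.norm_real, Real.norm_eq_abs]
    rw [max_comm 0, max_comm 0]
    refine (abs_max_sub_max_le_abs _ _ _).trans ?_ |>.trans (abs_abs_sub_abs_le_abs_sub x y)
    rw [sub_sub_sub_cancel_left, abs_sub_comm]
  · intro x
    unfold hat
    rw [Complex.norm_real, Real.norm_eq_abs, abs_of_nonneg (le_max_left _ _)]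
    exact max_le zero_le_one (by linarith [abs_nonneg x])
  · intro x hx
    unfold hat
    rw [max_eq_left (by linarith)]
    simp

lemma FL_hat_zero : FL hat 0 ≠ 0 := by
  have hc : Continuous (fun x : ℝ => max 0 (1 - |x|)) := by fun_prop
  have : FL hat 0 = ((∫ x : ℝ, max 0 (1 - |x|) : ℝ) : ℂ) := by
    rw [← integral_complex_ofReal]
    simp [FL, hat]
  rw [this]
  have hpos : 0 < ∫ x : ℝ, max 0 (1 - |x|) := by
    apply hc.integral_pos_of_hasCompactSupport_nonneg_nonzero (x := 0)
    · apply HasCompactSupport.intro (isCompact_Icc (a := (-1 : ℝ)) (b := 1))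
      intro x hx
      apply max_eq_left
      by_contra! hlt
      exact hx (abs_le.1 (by linarith))
    · intro x; exact le_max_left _ _
    · simp
  exact_mod_cast hpos.ne'

lemma norm_FL_le {b : ℝ} {F : ℝ → ℂ} (h : Good b F) (y : ℝ) : ‖FL F y‖ ≤ ∫ x, ‖F x‖ := by
  refine norm_integral_le_of_norm_le
    ((h.cont.integrable_of_hasCompactSupport (hasCompactSupport_of h.zero)).norm) ?_
  refine Eventually.of_forall fun x => ?_
  rw [norm_mul, Complex.norm_exp]
  simp

/-- Iterated averages. -/
def it (ρ : ℕ → ℝ) : ℕ → ℝ → ℂ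
  | 0 => hat
  | n + 1 => Av (ρ n) (it ρ n)

lemma good_it {ρ : ℕ → ℝ} (hρ : ∀ n, 0 ≤ ρ n) (n : ℕ) :
    Good (1 + ∑ k ∈ Finset.range n, ρ k) (it ρ n) := by
  induction n with
  | zero => simpa [it] using good_hat
  | succ n ih =>
    rw [Finset.sum_range_succ, ← add_assoc]
    exact ih.av (hρ n)

lemma FL_it {ρ : ℕ → ℝ} (hρ : ∀ n, 0 ≤ ρ n) (n : ℕ) (y : ℝ) :
    FL (it ρ n) y = FL hat y * ∏ k ∈ Finset.range n, mul (ρ k * y) := by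
  induction n with
  | zero => simp [it]
  | succ n ih =>
    rw [Finset.prod_range_succ, ← mul_assoc, ← ih]
    exact (good_it hρ n).FL_av (hρ n) y

/-- Existence of the infinite convolution. -/
lemma exists_limit {ρ : ℕ → ℝ} (hρ : ∀ n, 0 ≤ ρ n) (hsum : Summable ρ) :
    ∃ f : ℝ → ℂ, Good (1 + ∑' k, ρ k) f ∧
      ∀ y : ℝ, Tendsto (fun n => FL (it ρ n) y) atTop (nhds (FL f y)) := by
  have hle : ∀ n, ∑ k ∈ Finset.range n, ρ k ≤ ∑' k, ρ k := fun n =>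
    hsum.sum_le_tsum _ (fun k _ => hρ k)
  have hg : ∀ n, Good (1 + ∑' k, ρ k) (it ρ n) := fun n =>
    ⟨(good_it hρ n).lip, (good_it hρ n).bdd, fun x hx => (good_it hρ n).supp x (by
      linarith [hle n])⟩
  have hcau : ∀ x, ∃ l, Tendsto (fun n => it ρ n x) atTop (nhds l) := by
    intro x
    apply cauchySeq_tendsto_of_complete
    refine cauchySeq_of_dist_le_of_summable ρ (fun n => ?_) hsum
    rw [dist_eq_norm]
    exact (good_it hρ n).av_sub (hρ n) x
  choose f hf using hcau
  refine ⟨f, ⟨?_, ?_, ?_⟩, ?_⟩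
  · intro x y
    exact le_of_tendsto ((hf x).sub (hf y)).norm (Eventually.of_forall fun n => (hg n).lip x y)
  · intro x
    exact le_of_tendsto (hf x).norm (Eventually.of_forall fun n => (hg n).bdd x)
  · intro x hx
    refine tendsto_nhds_unique (hf x) ?_
    simp only [fun n => (hg n).supp x hx]
    exact tendsto_const_nhds
  · intro y
    set S := 1 + ∑' k, ρ k with hS
    refine tendsto_integral_of_dominated_convergence
      ((Set.Icc (-S) S).indicator fun _ => (1 : ℝ)) ?_ ?_ ?_ ?_
    · intro n
      have := (hg n).cont
      exact Continuous.aestronglyMeasurable (by fun_prop)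
    · rw [integrable_indicator_iff measurableSet_Icc]
      simp
    · intro n
      refine Eventually.of_forall fun x => ?_
      by_cases hx : x ∈ Set.Icc (-S) S
      · rw [Set.indicator_of_mem hx, norm_mul, Complex.norm_exp]
        simpa using (hg n).bdd x
      · rw [(hg n).zero x (fun h => hx (Set.Ioo_subset_Icc_self h))]
        simp [hx]
    · exact Eventually.of_forall fun x => (hf x).mul_const _

lemma summable_of_int {Θ : ℝ → ℝ} (hΘnonneg : ∀ y, 0 ≤ Θ y)
    (hΘdec : AntitoneOn Θ (Set.Ici 0))
    (hI : IntegrableOn (fun t => Θ t / t) (Set.Ici 1) volume) :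
    Summable (fun k : ℕ => Θ (k + 1 : ℝ) / (k + 1 : ℝ)) := by
  have hanti : AntitoneOn (fun t => Θ t / t) (Set.Ici 1) := by
    intro x hx y hy hxy
    have hx1 : (1 : ℝ) ≤ x := hx
    have hy1 : (1 : ℝ) ≤ y := hy
    apply div_le_div₀ (hΘnonneg x) _ (by linarith) hxy
    exact hΘdec (by simp; linarith) (by simp; linarith) hxy
  rw [← summable_nat_add_iff 1]
  refine summable_of_sum_range_le (c := ∫ t in Set.Ici 1, Θ t / t) ?_ ?_
  · intro n
    exact div_nonneg (hΘnonneg _) (by positivity)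
  · intro n
    have h1 := AntitoneOn.sum_le_integral (x₀ := 1) (a := n) (f := fun t => Θ t / t)
      (hanti.mono (fun x hx => hx.1))
    have h2 : ∫ x in (1 : ℝ)..1 + n, Θ x / x ≤ ∫ t in Set.Ici 1, Θ t / t := by
      rw [intervalIntegral.integral_of_le (by simp)]
      refine setIntegral_mono_set hI ?_ ?_
      · rw [EventuallyLE, ae_restrict_iff' measurableSet_Ici]
        refine Eventually.of_forall fun t ht => ?_
        have : (1 : ℝ) ≤ t := ht
        exact div_nonneg (hΘnonneg _) (by linarith)
      · exact Eventually.of_forall fun x hx => (hx.1.le : (1 : ℝ) ≤ x)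
    refine le_trans (le_of_eq ?_) (h1.trans h2)
    apply Finset.sum_congr rfl
    intro i _
    simp only [Nat.cast_add, Nat.cast_one]
    rw [add_comm (1 : ℝ) ((i : ℝ) + 1)]

lemma backward {Θ : ℝ → ℝ} (hΘnonneg : ∀ y, 0 ≤ Θ y) (hΘeven : ∀ y, Θ (-y) = Θ y)
    (hΘdec : AntitoneOn Θ (Set.Ici 0)) (hΘlim : Tendsto Θ atTop (nhds 0))
    (hI : IntegrableOn (fun t => Θ t / t) (Set.Ici 1) volume) :
    ∃ a > (0 : ℝ), ∃ C > (0 : ℝ), ∃ f : ℝ → ℂ,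
        Continuous f ∧ f ≠ 0 ∧ (∀ x, x ∉ Set.Ioo (-a) a → f x = 0) ∧
        ∀ y : ℝ, ‖FL f y‖ ≤ C * Real.exp (-|y| * Θ y) := by
  set ρ : ℕ → ℝ := fun k => 2 * Real.exp 1 * (Θ (k + 1 : ℝ) / (k + 1 : ℝ)) with hρd
  have hρ : ∀ n, 0 ≤ ρ n := fun n =>
    mul_nonneg (by positivity) (div_nonneg (hΘnonneg _) (by positivity))
  have hsum : Summable ρ := (summable_of_int hΘnonneg hΘdec hI).mul_left _
  obtain ⟨f, hgood, hlim⟩ := exists_limit hρ hsum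
  have hS : 0 ≤ ∑' k, ρ k := tsum_nonneg hρ
  obtain ⟨Y, hY0, hY⟩ : ∃ Y : ℝ, 0 ≤ Y ∧ ∀ y, Y ≤ y → Θ y ≤ 1 := by
    have := hΘlim.eventually (Iic_mem_nhds (zero_lt_one))
    obtain ⟨Y, hY⟩ := eventually_atTop.1 this
    exact ⟨max Y 0, le_max_right _ _, fun y hy => hY y ((le_max_left _ _).trans hy)⟩
  set D : ℝ := (∫ x, ‖hat x‖) with hD
  have hDpos : 0 < D := by
    have h1 := norm_FL_le good_hat 0
    have h2 : 0 < ‖FL hat (0 : ℝ)‖ := norm_pos_iff.2 (by simpa using FL_hat_zero)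
    exact h2.trans_le h1
  refine ⟨1 + ∑' k, ρ k, by positivity, D * (Real.exp 1 * Real.exp (Y * Θ 0)), by positivity,
    f, hgood.cont, ?_, hgood.zero, ?_⟩
  · rintro rfl
    have h1 := hlim 0
    simp only [FL_it hρ, mul_zero, mul_zero_eq, Finset.prod_const_one, mul_one] at h1
    have h2 := tendsto_nhds_unique h1 tendsto_const_nhds
    apply FL_hat_zero
    rw [Complex.ofReal_zero] at h2
    rw [← h2]
    simp [FL]
  · intro y
    have hYΘ : 0 ≤ Y * Θ 0 := mul_nonneg hY0 (hΘnonneg 0)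
    have hΘabs : Θ |y| = Θ y := by
      rcases abs_choice y with h | h <;> rw [h]
      exact hΘeven y
    have hit : ∀ n, ‖FL (it ρ n) y‖ ≤ D * ∏ k ∈ Finset.range n, ‖mul (ρ k * y)‖ := by
      intro n
      rw [FL_it hρ, norm_mul, norm_prod]
      exact mul_le_mul_of_nonneg_right (norm_FL_le good_hat y)
        (Finset.prod_nonneg fun _ _ => norm_nonneg _)
    rcases lt_or_ge |y| Y with hlt | hge
    · have h1 : |y| * Θ y ≤ Y * Θ 0 := by
        rw [← hΘabs]
        exact mul_le_mul hlt.le (hΘdec (Set.self_mem_Ici) (abs_nonneg y) (abs_nonneg y))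
          (hΘnonneg _) hY0
      have h2 : ‖FL f y‖ ≤ D := by
        refine le_of_tendsto (hlim y).norm (Eventually.of_forall fun n => (hit n).trans ?_)
        have : ∏ k ∈ Finset.range n, ‖mul (ρ k * y)‖ ≤ 1 :=
          Finset.prod_le_one (fun _ _ => norm_nonneg _) (fun _ _ => norm_mul_le_one _)
        nlinarith
      refine h2.trans ?_
      rw [mul_assoc, ← Real.exp_add, ← Real.exp_add]
      have : 1 ≤ Real.exp (1 + Y * Θ 0 + -|y| * Θ y) := by
        rw [Real.one_le_exp_iff]; linarith
      nlinarith
    · have hΘ1 : Θ y ≤ 1 := by rw [← hΘabs]; exact hY _ hge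
      set N := ⌊|y| * Θ y⌋₊ with hN
      have hnn : 0 ≤ |y| * Θ y := mul_nonneg (abs_nonneg _) (hΘnonneg _)
      have hNle : (N : ℝ) ≤ |y| * Θ y := Nat.floor_le hnn
      have hNlt : |y| * Θ y < N + 1 := Nat.lt_floor_add_one _
      have hfac : ∀ k ∈ Finset.range N, ‖mul (ρ k * y)‖ ≤ Real.exp (-1) := by
        intro k hk
        have hkN : (k + 1 : ℝ) ≤ N := by exact_mod_cast Finset.mem_range.1 hk
        have hk0 : (0 : ℝ) < k + 1 := by positivity
        have hprod : 0 < |y| * Θ y := by linarith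
        have hky : (k + 1 : ℝ) ≤ |y| := by
          nlinarith [abs_nonneg y]
        have hΘk : Θ y ≤ Θ (k + 1 : ℝ) := by
          rw [← hΘabs]
          exact hΘdec (hk0.le : (k + 1 : ℝ) ∈ Set.Ici (0 : ℝ)) (abs_nonneg y) hky
        have hbig : 2 * Real.exp 1 ≤ |ρ k * y| := by
          rw [abs_mul, abs_of_nonneg (hρ k)]
          simp only [hρd]
          rw [mul_assoc (2 * Real.exp 1)]
          have : 1 ≤ Θ (k + 1 : ℝ) / (k + 1 : ℝ) * |y| := by
            rw [div_mul_eq_mul_div, one_le_div hk0]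
            nlinarith [abs_nonneg y]
          nlinarith [Real.exp_pos 1]
        have hne : ρ k * y ≠ 0 := by
          intro h0
          rw [h0, abs_zero] at hbig
          linarith [Real.exp_pos 1]
        refine (norm_mul_le _ hne).trans ?_
        rw [Real.exp_neg, div_le_iff₀ (abs_pos.2 hne), inv_mul_eq_div, le_div_iff₀ (Real.exp_pos 1)]
        exact hbig
      have hfin : ‖FL f y‖ ≤ D * Real.exp (-(N : ℝ)) := by
        refine le_of_tendsto (hlim y).norm ?_
        filter_upwards [eventually_ge_atTop N] with n hn
        refine (hit n).trans ?_
        apply mul_le_mul_of_nonneg_left _ hDpos.le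
        calc ∏ k ∈ Finset.range n, ‖mul (ρ k * y)‖ ≤ ∏ k ∈ Finset.range N, ‖mul (ρ k * y)‖ := by
              apply Finset.prod_le_prod_of_subset_of_le_one
              · exact Finset.range_subset_range.2 hn
              · intro i _; exact norm_nonneg _
              · intro i _ _; exact norm_mul_le_one _
          _ ≤ ∏ k ∈ Finset.range N, Real.exp (-1) :=
              Finset.prod_le_prod (fun _ _ => norm_nonneg _) hfac
          _ = Real.exp (-(N : ℝ)) := by
              rw [Finset.prod_const, Finset.card_range, ← Real.exp_nat_mul]
              congr 1
              ring
      refine hfin.trans ?_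
      rw [mul_assoc, ← Real.exp_add, ← Real.exp_add]
      apply mul_le_mul_of_nonneg_left _ hDpos.le
      apply Real.exp_le_exp.2
      linarith

end InghamAux

/-- **Ingham's theorem on `ℝ`.** Let `Θ` be a nonnegative even function on `ℝ` which
decreases to zero as `y → ∞`. There exists a nonzero continuous function `f` on `ℝ`,
vanishing outside an interval `(-a, a)`, whose Fourier transform
`f̂(y) = ∫ f(x) e^{-ixy} dx` satisfies `|f̂(y)| ≤ C e^{-|y| Θ(y)}`, if and only if
`∫₁^∞ Θ(t) t⁻¹ dt < ∞`. -/
theorem ingham_real (Θ : ℝ → ℝ) (hΘnonneg : ∀ y, 0 ≤ Θ y) (hΘeven : ∀ y, Θ (-y) = Θ y)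
    (hΘdec : AntitoneOn Θ (Set.Ici 0)) (hΘlim : Tendsto Θ atTop (nhds 0)) :
    (∃ a > (0 : ℝ), ∃ C > (0 : ℝ), ∃ f : ℝ → ℂ,
        Continuous f ∧ f ≠ 0 ∧ (∀ x, x ∉ Set.Ioo (-a) a → f x = 0) ∧
        ∀ y : ℝ, ‖∫ x : ℝ, f x * Complex.exp (-Complex.I * (x : ℂ) * (y : ℂ))‖ ≤
          C * Real.exp (-|y| * Θ y)) ↔
      IntegrableOn (fun t => Θ t / t) (Set.Ici 1) volume := by
  constructor
  · rintro ⟨a, ha, C, hC, f, hf, hne, hs, hb⟩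
    exact InghamAux.forward hΘnonneg hΘdec ha hC hf hne hs hb
  · exact InghamAux.backward hΘnonneg hΘeven hΘdec hΘlim
end
end

section
/- (Sharp Laguerre function estimates.) Set ν(k) = 2(2k+n) and C_{k,n} = (k!(n−1)!/(k+n−1)!)^{1/2}. There exist constants C > 0 and γ > 0, depending only on n, such that for all integers k ≥ 0, all λ ≠ 0 and all r > 0: C_{k,n}|φ_{k,λ}^{n−1}(r)| ≤ C (r√|λ|)^{−(n−1)} · E, where E = ((1/2)ν(k)r²|λ|)^{(n−1)/2} if 0 ≤ r ≤ √2/√(ν(k)|λ|); E = ((1/2)ν(k)r²|λ|)^{−1/4} if √2/√(ν(k)|λ|) ≤ r ≤ √(ν(k))/√|λ|; E = ν(k)^{−1/4}(ν(k)^{1/3} + |ν(k) − (1/2)|λ|r²|)^{−1/4} if √(ν(k))/√|λ| ≤ r ≤ √(3ν(k))/√|λ|; and E = e^{−(1/2)γ r² |λ|} if r ≥ √(3ν(k))/√|λ|. -/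
open MeasureTheory Filter
open scoped ENNReal

noncomputable section

/-- The Laguerre polynomial of type `δ`:
`L_k^δ(t) = ∑_{j=0}^k [Γ(k+δ+1)/(Γ(j+δ+1)Γ(k-j+1))] (-t)^j / j!`. -/
def laguerreL (k : ℕ) (δ : ℝ) (t : ℝ) : ℝ :=
  ∑ j ∈ Finset.range (k + 1),
    (Real.Gamma ((k : ℝ) + δ + 1) /
        (Real.Gamma ((j : ℝ) + δ + 1) * (Nat.factorial (k - j)))) *
      (-t) ^ j / (Nat.factorial j)

/-- The Laguerre function `φ_{k,λ}^{n-1}(r) = L_k^{n-1}((1/2)|λ|r²) e^{-(1/4)|λ|r²}`. -/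
def lagPhi (n k : ℕ) (lam r : ℝ) : ℝ :=
  laguerreL k ((n : ℝ) - 1) ((1/2) * |lam| * r ^ 2) * Real.exp (-(1/4) * |lam| * r ^ 2)

/-- `ν(k) = 2(2k+n)`. -/
def nuk (n k : ℕ) : ℝ := 2 * (2 * (k : ℝ) + n)

/-- `C_{k,n} = (k!(n-1)!/(k+n-1)!)^{1/2}`. -/
def Ckn (n k : ℕ) : ℝ :=
  Real.sqrt ((Nat.factorial k * Nat.factorial (n - 1) : ℝ) / (Nat.factorial (k + n - 1)))


lemma aux_anti (f f' : ℝ → ℝ) (a b : ℝ) (hab : a ≤ b)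
    (h : ∀ t, a ≤ t → t ≤ b → HasDerivAt f (f' t) t)
    (h' : ∀ t, a ≤ t → t ≤ b → f' t ≤ 0) : f b ≤ f a := by
  have : AntitoneOn f (Set.Icc a b) := by
    apply antitoneOn_of_deriv_nonpos (convex_Icc a b)
    · intro t ht
      exact (h t ht.1 ht.2).continuousAt.continuousWithinAt
    · intro t ht
      rw [interior_Icc] at ht
      exact (h t ht.1.le ht.2.le).differentiableAt.differentiableWithinAt
    · intro t ht
      rw [interior_Icc] at ht
      rw [(h t ht.1.le ht.2.le).deriv]
      exact h' t ht.1.le ht.2.le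
  exact this (Set.left_mem_Icc.2 hab) (Set.right_mem_Icc.2 hab) hab

lemma aux_inf (f f' : ℝ → ℝ) (a : ℝ)
    (h : ∀ t, a ≤ t → HasDerivAt f (f' t) t)
    (h' : ∀ t, a ≤ t → 0 ≤ f' t) (hl : Tendsto f atTop (nhds 0)) : f a ≤ 0 := by
  apply ge_of_tendsto hl
  filter_upwards [eventually_ge_atTop a] with b hb
  have := aux_anti (fun t => - f t) (fun t => - f' t) a b hb (fun t h1 _ => (h t h1).neg)
    (fun t h1 _ => by have := h' t h1; simpa using this)
  simpa using this

structure LSys (s q M : ℝ) (u v : ℝ → ℝ) : Prop where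
  hs : 1 ≤ s
  hs6 : 2 ≤ s ^ 6
  hq : -(1/4) ≤ q
  hM : 0 ≤ M
  du : ∀ t, 0 < t → HasDerivAt u (v t) t
  dv : ∀ t, 0 < t → HasDerivAt v (-(s ^ 6 - t ^ 2 - q / t ^ 2) * u t) t
  iu : u (1 / s ^ 3) ^ 2 ≤ M / s ^ 3
  iv : v (1 / s ^ 3) ^ 2 ≤ M * s ^ 3
  lu : Tendsto (fun t => t * u t) atTop (nhds 0)
  lv : Tendsto v atTop (nhds 0)

def LH (s : ℝ) (u v : ℝ → ℝ) (t : ℝ) : ℝ :=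
  Real.sqrt (s ^ 6 - t ^ 2) * u t ^ 2 +
    (v t - t / (2 * (Real.sqrt (s ^ 6 - t ^ 2)) ^ 2) * u t) ^ 2 / Real.sqrt (s ^ 6 - t ^ 2)

def LPhi (s D t : ℝ) : ℝ :=
  t / (2 * (Real.sqrt (s ^ 6 - t ^ 2)) ^ 3) - D * Real.sqrt (s ^ 6 - t ^ 2) / (s ^ 6 * t)

lemma two_abs_le (σ a b : ℝ) (hσ : 0 < σ) : 2 * |a * b| ≤ σ * a ^ 2 + b ^ 2 / σ := by
  have h : σ * a ^ 2 + b ^ 2 / σ - 2 * (|a| * |b|) = (σ * |a| - |b|) ^ 2 / σ := by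
    rw [← sq_abs a, ← sq_abs b]
    field_simp
    ring
  rw [abs_mul]
  have : 0 ≤ (σ * |a| - |b|) ^ 2 / σ := by positivity
  linarith

lemma L1_mono {s q M : ℝ} {u v : ℝ → ℝ} (S : LSys s q M u v) (a b : ℝ) (ha : 0 < a)
    (hab : a ≤ b) (hb : b ^ 2 < s ^ 6) :
    LH s u v b * Real.exp (-LPhi s |q| b) ≤ LH s u v a * Real.exp (-LPhi s |q| a) := by
  have hs : 0 < s := by linarith [S.hs]
  set σ : ℝ → ℝ := fun t => Real.sqrt (s ^ 6 - t ^ 2) with hσdef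
  have hP : ∀ t, a ≤ t → t ≤ b → 0 < s ^ 6 - t ^ 2 := by
    intro t h1 h2
    nlinarith
  have hσ : ∀ t, a ≤ t → t ≤ b → 0 < σ t := fun t h1 h2 => Real.sqrt_pos.2 (hP t h1 h2)
  have hσ2 : ∀ t, a ≤ t → t ≤ b → σ t ^ 2 = s ^ 6 - t ^ 2 :=
    fun t h1 h2 => Real.sq_sqrt (hP t h1 h2).le
  have dσ : ∀ t, a ≤ t → t ≤ b → HasDerivAt σ (-t / σ t) t := by
    intro t h1 h2
    have h := (((hasDerivAt_id t).pow 2).const_sub (s ^ 6)).sqrt (hP t h1 h2).ne'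
    refine h.congr_deriv ?_
    have h3 : 0 < Real.sqrt (s ^ 6 - t ^ 2) := hσ t h1 h2
    change -((2 : ℕ) * t ^ (2 - 1) * 1) / (2 * Real.sqrt (s ^ 6 - t ^ 2)) =
      -t / Real.sqrt (s ^ 6 - t ^ 2)
    push_cast
    field_simp
  let y : ℝ → ℝ := fun t => v t - t / (2 * σ t ^ 2) * u t
  let H' : ℝ → ℝ := fun t => -(2 / σ t) * (-(q / t ^ 2) + 1 / (2 * σ t ^ 2)
    + 5 * t ^ 2 / (4 * σ t ^ 4)) * (u t * y t)
  let Φ' : ℝ → ℝ := fun t => 1 / (2 * σ t ^ 3) + 3 * t ^ 2 / (2 * σ t ^ 5)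
    + |q| / (t ^ 2 * σ t)
  have dH : ∀ t, a ≤ t → t ≤ b → HasDerivAt (LH s u v) (H' t) t := by
    intro t h1 h2
    have ht : 0 < t := by linarith
    have d1 := dσ t h1 h2
    have d2 := S.du t ht
    have d3 := S.dv t ht
    have h3 := hσ t h1 h2
    have h4 := hσ2 t h1 h2
    have hy := d3.sub ((((hasDerivAt_id t)).div ((d1.pow 2).const_mul 2)
      (show 2 * σ t ^ 2 ≠ 0 by positivity)).mul d2)
    have := (d1.mul (d2.pow 2)).add ((hy.pow 2).div d1 h3.ne')
    refine (this.congr_deriv ?_)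
    simp only [H', y, id, Pi.pow_apply, Pi.mul_apply, Pi.sub_apply, Pi.div_apply,
      Nat.add_one_sub_one, Nat.reduceSub, pow_one, Nat.cast_ofNat]
    rw [show s ^ 6 = σ t ^ 2 + t ^ 2 by linarith]
    generalize σ t = z at *
    generalize u t = U at *
    generalize v t = V at *
    field_simp
    ring
  have dΦ : ∀ t, a ≤ t → t ≤ b → HasDerivAt (LPhi s |q|) (Φ' t) t := by
    intro t h1 h2
    have ht : 0 < t := by linarith
    have d1 := dσ t h1 h2
    have h3 := hσ t h1 h2
    have h4 := hσ2 t h1 h2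
    have := ((hasDerivAt_id t).div ((d1.pow 3).const_mul 2)
      (show 2 * σ t ^ 3 ≠ 0 by positivity)).sub
      ((d1.const_mul |q|).div ((hasDerivAt_id t).const_mul (s ^ 6)) (show s ^ 6 * t ≠ 0 by positivity))
    refine (this.congr_deriv ?_)
    simp only [Φ', id, Pi.pow_apply, Pi.mul_apply, Pi.sub_apply, Pi.div_apply,
      Nat.add_one_sub_one, Nat.reduceSub, pow_one, Nat.cast_ofNat]
    rw [show s ^ 6 = σ t ^ 2 + t ^ 2 by linarith]
    generalize σ t = z at *
    field_simp
    ring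
  refine aux_anti (fun t => LH s u v t * Real.exp (-LPhi s |q| t))
    (fun t => (H' t - Φ' t * LH s u v t) * Real.exp (-LPhi s |q| t)) a b hab ?_ ?_
  · intro t h1 h2
    refine ((dH t h1 h2).mul (dΦ t h1 h2).neg.exp).congr_deriv ?_
    simp only [Pi.neg_apply]
    ring
  · intro t h1 h2
    have ht : 0 < t := by linarith
    have h3 := hσ t h1 h2
    apply mul_nonpos_of_nonpos_of_nonneg _ (Real.exp_pos _).le
    have e1 := two_abs_le (σ t) (u t) (y t) h3
    have e2 : LH s u v t = σ t * u t ^ 2 + y t ^ 2 / σ t := rfl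
    rw [← e2] at e1
    have hH : 0 ≤ LH s u v t := le_trans (by positivity) e1
    have e3 : |H' t| = (1 / σ t) * |(-(q / t ^ 2) + 1 / (2 * σ t ^ 2)
        + 5 * t ^ 2 / (4 * σ t ^ 4))| * (2 * |u t * y t|) := by
      simp only [H', abs_mul, abs_neg, abs_div, abs_of_pos h3]
      simp
      ring
    have e4 : |(-(q / t ^ 2) + 1 / (2 * σ t ^ 2) + 5 * t ^ 2 / (4 * σ t ^ 4))|
        ≤ |q| / t ^ 2 + 1 / (2 * σ t ^ 2) + 5 * t ^ 2 / (4 * σ t ^ 4) := by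
      refine (abs_add_three _ _ _).trans ?_
      rw [abs_neg, abs_div, abs_of_pos (show 0 < t ^ 2 by positivity),
        abs_of_pos (show 0 < 1 / (2 * σ t ^ 2) by positivity),
        abs_of_pos (show 0 < 5 * t ^ 2 / (4 * σ t ^ 4) by positivity)]
    have e5 : (1 / σ t) * (|q| / t ^ 2 + 1 / (2 * σ t ^ 2) + 5 * t ^ 2 / (4 * σ t ^ 4)) ≤ Φ' t := by
      have : Φ' t - (1 / σ t) * (|q| / t ^ 2 + 1 / (2 * σ t ^ 2) + 5 * t ^ 2 / (4 * σ t ^ 4))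
          = t ^ 2 / (4 * σ t ^ 5) := by
        simp only [Φ']
        field_simp
        ring
      have h6 : 0 ≤ t ^ 2 / (4 * σ t ^ 5) := by positivity
      linarith
    have : |H' t| ≤ Φ' t * LH s u v t := by
      rw [e3]
      have : (1 / σ t) * |(-(q / t ^ 2) + 1 / (2 * σ t ^ 2) + 5 * t ^ 2 / (4 * σ t ^ 4))| ≤ Φ' t :=
        (mul_le_mul_of_nonneg_left e4 (by positivity)).trans e5
      exact mul_le_mul this e1 (by positivity) (le_trans (by positivity) this)
    linarith [le_abs_self (H' t)]

lemma L1 {s q M : ℝ} {u v : ℝ → ℝ} (S : LSys s q M u v) (t : ℝ) (ht : 1 / s ^ 3 ≤ t)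
    (ht2 : t ^ 2 ≤ s ^ 6 - s ^ 2 / 2) :
    LH s u v t ≤ 9 * M * Real.exp (4 + |q|) := by
  have hs1 := S.hs
  have hs6 := S.hs6
  have hM := S.hM
  have hs : 0 < s := by linarith
  have h0 : 0 < 1 / s ^ 3 := by positivity
  have hm := L1_mono S (1 / s ^ 3) t h0 ht (by nlinarith)
  -- initial value
  have hi6 : (1 / s ^ 3) ^ 2 ≤ s ^ 6 / 4 := by
    rw [div_pow, ← pow_mul, one_pow, div_le_iff₀ (by positivity)]
    norm_num
    nlinarith
  have hσ0 : s ^ 3 / 2 ≤ Real.sqrt (s ^ 6 - (1 / s ^ 3) ^ 2) := by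
    apply Real.le_sqrt_of_sq_le
    nlinarith
  have hσ1 : Real.sqrt (s ^ 6 - (1 / s ^ 3) ^ 2) ≤ s ^ 3 := by
    apply Real.sqrt_le_iff.2
    refine ⟨by positivity, ?_⟩
    have : 0 ≤ (1 / s ^ 3) ^ 2 := by positivity
    nlinarith
  have hH0 : LH s u v (1 / s ^ 3) ≤ 9 * M := by
    unfold LH
    have iu := S.iu
    have iv := S.iv
    generalize Real.sqrt (s ^ 6 - (1 / s ^ 3) ^ 2) = z at *
    generalize u (1 / s ^ 3) = U at *
    generalize v (1 / s ^ 3) = V at *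
    have hs3 : 1 ≤ s ^ 3 := one_le_pow₀ hs1
    have hz : 0 < z := by linarith [show 0 < s ^ 3 by positivity]
    have hc0 : 0 ≤ 1 / s ^ 3 / (2 * z ^ 2) := by positivity
    have hc : 1 / s ^ 3 / (2 * z ^ 2) ≤ s ^ 3 := by
      rw [div_div, div_le_iff₀ (by positivity)]
      have h4 : (s ^ 3 / 2) ^ 2 ≤ z ^ 2 := by gcongr
      have h5 : s ^ 3 * (s ^ 3 * (2 * z ^ 2)) = 2 * s ^ 6 * z ^ 2 := by ring
      rw [h5]
      nlinarith
    generalize 1 / s ^ 3 / (2 * z ^ 2) = c at *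
    have hc2 : c ^ 2 ≤ s ^ 6 := by
      calc c ^ 2 ≤ (s ^ 3) ^ 2 := by gcongr
        _ = s ^ 6 := by ring
    have h1 : z * U ^ 2 ≤ M := by
      calc z * U ^ 2 ≤ s ^ 3 * (M / s ^ 3) := by gcongr
        _ = M := by field_simp
    have h2 : (V - c * U) ^ 2 ≤ 4 * M * s ^ 3 := by
      have h3 : c ^ 2 * U ^ 2 ≤ s ^ 6 * (M / s ^ 3) := by gcongr
      have h4 : s ^ 6 * (M / s ^ 3) = M * s ^ 3 := by field_simp
      nlinarith [sq_nonneg (V + c * U)]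
    have h3 : (V - c * U) ^ 2 / z ≤ 8 * M := by
      rw [div_le_iff₀ hz]
      nlinarith
    linarith
  -- phase
  have hφ0 : -LPhi s |q| (1 / s ^ 3) ≤ |q| := by
    unfold LPhi
    generalize Real.sqrt (s ^ 6 - (1 / s ^ 3) ^ 2) = z at *
    have hz : 0 < z := by linarith [show 0 < s ^ 3 by positivity]
    have h1 : |q| * z / (s ^ 6 * (1 / s ^ 3)) ≤ |q| := by
      have : s ^ 6 * (1 / s ^ 3) = s ^ 3 := by field_simp
      rw [this, div_le_iff₀ (by positivity)]
      gcongr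
    have h2 : 0 ≤ 1 / s ^ 3 / (2 * z ^ 3) := by positivity
    linarith
  have hφ1 : LPhi s |q| t ≤ 4 := by
    unfold LPhi
    have hσ : s / 2 ≤ Real.sqrt (s ^ 6 - t ^ 2) := by
      apply Real.le_sqrt_of_sq_le
      nlinarith
    generalize Real.sqrt (s ^ 6 - t ^ 2) = z at *
    have hz : 0 < z := by linarith
    have ht0 : 0 < t := by linarith
    have ht3 : t ≤ s ^ 3 := by
      refine (sq_le_sq₀ ht0.le (by positivity)).1 ?_
      nlinarith
    have h1 : t / (2 * z ^ 3) ≤ 4 := by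
      rw [div_le_iff₀ (by positivity)]
      have : (s / 2) ^ 3 ≤ z ^ 3 := by gcongr
      nlinarith
    have h2 : 0 ≤ |q| * z / (s ^ 6 * t) := by positivity
    linarith
  have hH0' : 0 ≤ LH s u v (1 / s ^ 3) := by unfold LH; positivity
  have e1 : LH s u v t = LH s u v t * Real.exp (-LPhi s |q| t) * Real.exp (LPhi s |q| t) := by
    rw [mul_assoc, ← Real.exp_add]; simp
  rw [e1]
  calc _ ≤ LH s u v (1 / s ^ 3) * Real.exp (-LPhi s |q| (1 / s ^ 3)) * Real.exp (LPhi s |q| t) := by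
        gcongr
    _ ≤ 9 * M * Real.exp |q| * Real.exp 4 := by gcongr
    _ = _ := by rw [mul_assoc, ← Real.exp_add, add_comm]


lemma L2_alg (s z c U V B : ℝ) (hs : 0 < s) (hz : 0 < z) (hz1 : s / 2 ≤ z) (hz2 : z ≤ s)
    (hc0 : 0 ≤ c) (hc : c ≤ s) (hB : z * U ^ 2 + (V - c * U) ^ 2 / z ≤ B) :
    s ^ 2 * U ^ 2 + V ^ 2 ≤ 8 * s * B := by
  have e1 : 0 ≤ (V - c * U) ^ 2 / z := by positivity
  have e2 : 0 ≤ z * U ^ 2 := by positivity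
  have hB0 : 0 ≤ B := by linarith
  have e3 : (V - c * U) ^ 2 ≤ B * s := by
    have h5 : (V - c * U) ^ 2 / z ≤ B := by linarith
    rw [div_le_iff₀ hz] at h5
    exact h5.trans (by gcongr)
  have e4 : s / 2 * U ^ 2 ≤ z * U ^ 2 := by gcongr
  have e5 : s * (s / 2 * U ^ 2) ≤ s * B := by
    gcongr
    linarith
  have e6 : c ^ 2 * U ^ 2 ≤ s ^ 2 * U ^ 2 := by gcongr
  have e7 : V ^ 2 ≤ 2 * (V - c * U) ^ 2 + 2 * (c ^ 2 * U ^ 2) := by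
    linarith [sq_nonneg (V - 2 * c * U)]
  linarith

/-- Crossing the turning point. -/
lemma L2 {s q M : ℝ} {u v : ℝ → ℝ} (S : LSys s q M u v) (B : ℝ)
    (hB : LH s u v (Real.sqrt (s ^ 6 - s ^ 2 / 2)) ≤ B) (t : ℝ) (ht0 : 0 < t)
    (ht1 : s ^ 6 - s ^ 2 / 2 ≤ t ^ 2) (ht2 : t ^ 2 ≤ s ^ 6 + s ^ 2 / 2) :
    u t ^ 2 ≤ 8 * B * Real.exp (2 + |q|) / s := by
  have hs1 := S.hs
  have hs6 := S.hs6
  have hs : 0 < s := by linarith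
  have hs26 : s ^ 2 ≤ s ^ 6 := pow_le_pow_right₀ hs1 (by norm_num)
  have hp : 0 < s ^ 6 - s ^ 2 / 2 := by nlinarith
  set a := Real.sqrt (s ^ 6 - s ^ 2 / 2) with ha
  have ha0 : 0 < a := Real.sqrt_pos.2 hp
  have ha2 : a ^ 2 = s ^ 6 - s ^ 2 / 2 := Real.sq_sqrt hp.le
  have hat : a ≤ t := by
    refine (sq_le_sq₀ ha0.le ht0.le).1 ?_
    linarith
  have hs36 : s ^ 6 = (s ^ 3) ^ 2 := by ring
  have has : s ^ 3 / 2 ≤ a := by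
    refine (sq_le_sq₀ (by positivity) ha0.le).1 ?_
    nlinarith
  have has' : a ≤ s ^ 3 := by
    refine (sq_le_sq₀ ha0.le (by positivity)).1 ?_
    nlinarith
  have hdiff : s * (t - a) ≤ 1 := by
    have h1 : (t - a) * (t + a) ≤ s ^ 2 := by nlinarith
    have h2 : (t - a) * s ^ 3 ≤ (t - a) * (t + a) :=
      mul_le_mul_of_nonneg_left (by linarith) (by linarith)
    have h3 : s ^ 2 * (s * (t - a)) ≤ s ^ 2 * 1 := by nlinarith
    exact le_of_mul_le_mul_left h3 (by positivity)
  -- the energy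
  let K : ℝ → ℝ := fun x => s ^ 2 * u x ^ 2 + v x ^ 2
  let K' : ℝ → ℝ := fun x => 2 * (u x * v x) * (s ^ 2 - (s ^ 6 - x ^ 2 - q / x ^ 2))
  have hK : ∀ x, 2 * s * |u x * v x| ≤ K x := by
    intro x
    simp only [K]
    rw [abs_mul, ← sq_abs (u x), ← sq_abs (v x)]
    nlinarith [sq_nonneg (s * |u x| - |v x|)]
  have hmono : K t * Real.exp (-((2 + |q|) * s * t)) ≤ K a * Real.exp (-((2 + |q|) * s * a)) := by
    refine aux_anti (fun x => K x * Real.exp (-((2 + |q|) * s * x)))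
      (fun x => (K' x - (2 + |q|) * s * K x) * Real.exp (-((2 + |q|) * s * x))) a t hat ?_ ?_
    · intro x h1 h2
      have hx : 0 < x := by linarith
      have d := (((S.du x hx).pow 2).const_mul (s ^ 2)).add ((S.dv x hx).pow 2)
      have e := ((hasDerivAt_id x).const_mul ((2 + |q|) * s)).neg.exp
      refine (d.mul e).congr_deriv ?_
      simp only [K', K, Pi.neg_apply, Pi.pow_apply, Pi.add_apply, id, Nat.add_one_sub_one, pow_one,
        Nat.cast_ofNat]
      ring
    · intro x h1 h2
      have hx : 0 < x := by linarith
      apply mul_nonpos_of_nonpos_of_nonneg _ (Real.exp_pos _).le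
      have hx1 : a ^ 2 ≤ x ^ 2 := by gcongr
      have hx2 : x ^ 2 ≤ t ^ 2 := by gcongr
      have hx3 : 1 ≤ x ^ 2 := by nlinarith
      have hq : |q / x ^ 2| ≤ |q| := by
        rw [abs_div, abs_of_pos (show 0 < x ^ 2 by positivity)]
        exact div_le_self (abs_nonneg _) hx3
      have hs2 : 1 ≤ s ^ 2 := one_le_pow₀ hs1
      have hQ : |s ^ 2 - (s ^ 6 - x ^ 2 - q / x ^ 2)| ≤ (2 + |q|) * s ^ 2 := by
        have := abs_le.1 hq
        have h5 : |q| ≤ |q| * s ^ 2 := le_mul_of_one_le_right (abs_nonneg _) hs2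
        rw [abs_le]
        constructor <;> nlinarith
      have h6 : K' x ≤ (2 + |q|) * s * K x := by
        calc K' x ≤ |K' x| := le_abs_self _
          _ = 2 * |u x * v x| * |s ^ 2 - (s ^ 6 - x ^ 2 - q / x ^ 2)| := by
            simp only [K']; rw [abs_mul, abs_mul]; simp
          _ ≤ 2 * |u x * v x| * ((2 + |q|) * s ^ 2) := by gcongr
          _ = (2 + |q|) * s * (2 * s * |u x * v x|) := by ring
          _ ≤ _ := by
            have := hK x
            gcongr
      linarith
  have hKa : K a ≤ 8 * s * B := by
    unfold LH at hB
    have h1 : s ^ 6 - a ^ 2 = s ^ 2 / 2 := by linarith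
    rw [h1] at hB
    have hz1 : s / 2 ≤ Real.sqrt (s ^ 2 / 2) := Real.le_sqrt_of_sq_le (by nlinarith)
    have hz2 : Real.sqrt (s ^ 2 / 2) ≤ s := Real.sqrt_le_iff.2 ⟨hs.le, by nlinarith⟩
    have hz3 : Real.sqrt (s ^ 2 / 2) ^ 2 = s ^ 2 / 2 := Real.sq_sqrt (by positivity)
    rw [hz3] at hB
    simp only [K]
    generalize Real.sqrt (s ^ 2 / 2) = z at *
    generalize u a = U at *
    generalize v a = V at *
    have hz : 0 < z := by linarith
    have hc0 : 0 ≤ a / (2 * (s ^ 2 / 2)) := by positivity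
    have hc : a / (2 * (s ^ 2 / 2)) ≤ s := by
      rw [div_le_iff₀ (by positivity)]
      nlinarith
    generalize a / (2 * (s ^ 2 / 2)) = c at *
    exact L2_alg s z c U V B hs hz hz1 hz2 hc0 hc hB
  have hB0 : 0 ≤ K a := by simp only [K]; positivity
  have hKt : K t ≤ 8 * s * B * Real.exp (2 + |q|) := by
    calc K t = K t * Real.exp (-((2 + |q|) * s * t)) * Real.exp ((2 + |q|) * s * t) := by
          rw [mul_assoc, ← Real.exp_add]; simp
      _ ≤ K a * Real.exp (-((2 + |q|) * s * a)) * Real.exp ((2 + |q|) * s * t) := by gcongr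
      _ = K a * Real.exp ((2 + |q|) * (s * (t - a))) := by
          rw [mul_assoc, ← Real.exp_add]; ring_nf
      _ ≤ (8 * s * B) * Real.exp ((2 + |q|) * 1) := by
          have : 0 ≤ |q| := abs_nonneg q
          gcongr
          linarith
      _ = _ := by rw [mul_one]
  rw [le_div_iff₀ hs]
  have : s ^ 2 * u t ^ 2 ≤ K t := by simp only [K]; nlinarith [sq_nonneg (v t)]
  nlinarith

lemma L3 {s q M : ℝ} {u v : ℝ → ℝ} (S : LSys s q M u v) (t : ℝ) (ht0 : 0 < t)
    (ht1 : s ^ 6 + 1 / 8 ≤ t ^ 2) :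
    u t * v t ≤ -(Real.sqrt (t ^ 2 - s ^ 6 - 1 / 8) * u t ^ 2) := by
  have hs1 := S.hs
  have hs6 := S.hs6
  have hq := S.hq
  have lu0 : Tendsto u atTop (nhds 0) := by
    have := (tendsto_inv_atTop_zero (𝕜 := ℝ)).mul S.lu
    rw [mul_zero] at this
    refine this.congr' ?_
    filter_upwards [eventually_gt_atTop 0] with x hx
    field_simp
  have hR : ∀ x, t ≤ x → x ^ 2 - s ^ 6 - 1 / 8 ≤ -(s ^ 6 - x ^ 2 - q / x ^ 2) := by
    intro x hx
    have h1 : t ^ 2 ≤ x ^ 2 := by gcongr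
    have hx0 : 0 < x := by linarith
    have h2 : -(1 / 8) ≤ q / x ^ 2 := by
      rw [le_div_iff₀ (by positivity)]
      nlinarith
    linarith
  have hS : ∀ x, t ≤ x → 0 ≤ x ^ 2 - s ^ 6 - 1 / 8 := by
    intro x hx
    have h1 : t ^ 2 ≤ x ^ 2 := by gcongr
    linarith
  have huv : ∀ x, t ≤ x → u x * v x ≤ 0 := by
    intro x hx
    refine aux_inf (fun x => u x * v x)
      (fun x => v x ^ 2 + -(s ^ 6 - x ^ 2 - q / x ^ 2) * u x ^ 2) x ?_ ?_ ?_
    · intro y hy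
      refine ((S.du y (by linarith)).mul (S.dv y (by linarith))).congr_deriv ?_
      ring
    · intro y hy
      have h1 := hR y (by linarith)
      have h2 := hS y (by linarith)
      have h3 : 0 ≤ -(s ^ 6 - y ^ 2 - q / y ^ 2) := by linarith
      positivity
    · simpa using lu0.mul S.lv
  have hE : (t ^ 2 - s ^ 6 - 1 / 8) * u t ^ 2 - v t ^ 2 ≤ 0 := by
    refine aux_inf (fun x => (x ^ 2 - s ^ 6 - 1 / 8) * u x ^ 2 - v x ^ 2)
      (fun x => 2 * x * u x ^ 2 + 2 * (u x * v x) * ((x ^ 2 - s ^ 6 - 1 / 8)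
        - -(s ^ 6 - x ^ 2 - q / x ^ 2))) t ?_ ?_ ?_
    · intro y hy
      have d1 := S.du y (by linarith)
      have d2 := S.dv y (by linarith)
      have d3 := (((hasDerivAt_id y).pow 2).sub_const (s ^ 6)).sub_const (1 / 8)
      refine ((d3.mul (d1.pow 2)).sub (d2.pow 2)).congr_deriv ?_
      simp only [Pi.pow_apply, id, Nat.add_one_sub_one, pow_one, Nat.cast_ofNat]
      ring
    · intro y hy
      have h1 := hR y hy
      have h2 := huv y hy
      have h3 : 0 ≤ 2 * y * u y ^ 2 := by
        have : 0 < y := by linarith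
        positivity
      nlinarith
    · have h1 := S.lu.pow 2
      have h2 := (lu0.pow 2).const_mul (s ^ 6 + 1 / 8)
      have h3 := S.lv.pow 2
      have := (h1.sub h2).sub h3
      norm_num at this
      refine this.congr ?_
      intro x
      ring
  have h1 := huv t le_rfl
  have h2 := hS t le_rfl
  have h3 : (Real.sqrt (t ^ 2 - s ^ 6 - 1 / 8) * u t ^ 2) ^ 2 ≤ (-(u t * v t)) ^ 2 := by
    rw [mul_pow, Real.sq_sqrt h2]
    nlinarith [sq_nonneg (u t)]
  have := (sq_le_sq₀ (by positivity) (by linarith)).1 h3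
  linarith

lemma L4 {s q M : ℝ} {u v : ℝ → ℝ} (S : LSys s q M u v) (B : ℝ)
    (hB : u (Real.sqrt (s ^ 6 + s ^ 2 / 2)) ^ 2 ≤ B / s) (t : ℝ) (ht0 : 0 < t)
    (ht1 : s ^ 6 + s ^ 2 / 2 ≤ t ^ 2) (ht2 : t ^ 2 ≤ 3 / 2 * s ^ 6) :
    u t ^ 2 * Real.sqrt (t ^ 2 - s ^ 6 - 1 / 8 + s ^ 2) ≤ 2 * B := by
  have hs1 := S.hs
  have hs6 := S.hs6
  have hs : 0 < s := by linarith
  have hs2 : 1 ≤ s ^ 2 := one_le_pow₀ hs1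
  set b := Real.sqrt (s ^ 6 + s ^ 2 / 2) with hb
  have hb0 : 0 < b := Real.sqrt_pos.2 (by positivity)
  have hb2 : b ^ 2 = s ^ 6 + s ^ 2 / 2 := Real.sq_sqrt (by positivity)
  have hbt : b ≤ t := by
    refine (sq_le_sq₀ hb0.le ht0.le).1 ?_
    linarith
  have hmono := aux_anti (fun x => u x ^ 2 * Real.sqrt (x ^ 2 - s ^ 6 - 1 / 8 + s ^ 2))
    (fun x => 2 * (u x * v x) * Real.sqrt (x ^ 2 - s ^ 6 - 1 / 8 + s ^ 2)
      + u x ^ 2 * (x / Real.sqrt (x ^ 2 - s ^ 6 - 1 / 8 + s ^ 2))) b t hbt ?_ ?_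
  · refine hmono.trans ?_
    have h1 : Real.sqrt (b ^ 2 - s ^ 6 - 1 / 8 + s ^ 2) ≤ 2 * s :=
      Real.sqrt_le_iff.2 ⟨by positivity, by nlinarith⟩
    have h2 : 0 ≤ B / s := le_trans (by positivity) hB
    calc _ ≤ B / s * (2 * s) := by gcongr
      _ = 2 * B := by field_simp
  · intro x h1 h2
    have hx2 : b ^ 2 ≤ x ^ 2 := by gcongr
    have hx : 0 < x := by linarith
    have hpos : 0 < x ^ 2 - s ^ 6 - 1 / 8 + s ^ 2 := by nlinarith
    have d := (((((hasDerivAt_id x).pow 2).sub_const (s ^ 6)).sub_const (1 / 8)).add_const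
      (s ^ 2)).sqrt hpos.ne'
    have d1 := S.du x hx
    refine ((d1.pow 2).mul d).congr_deriv ?_
    have h5 := Real.sqrt_pos.2 hpos
    simp only [Pi.pow_apply, id, Nat.add_one_sub_one, pow_one, Nat.cast_ofNat]
    field_simp
  · intro x h1 h2
    have hx2 : b ^ 2 ≤ x ^ 2 := by gcongr
    have hx : 0 < x := by linarith
    have hxt : x ^ 2 ≤ t ^ 2 := by gcongr
    have h3 := L3 S x hx (by nlinarith)
    set A := x ^ 2 - s ^ 6 - 1 / 8 with hA
    have hA0 : 3 / 8 * s ^ 2 ≤ A := by nlinarith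
    have hA1 : 0 < A := by nlinarith
    have hpos : 0 < A + s ^ 2 := by positivity
    have h5 := Real.sqrt_pos.2 hpos
    have h6 := Real.sq_sqrt hpos.le
    have h7 := Real.sq_sqrt hA1.le
    have h8 := Real.sqrt_pos.2 hA1
    set z := Real.sqrt (A + s ^ 2)
    set w := Real.sqrt A
    have h9 : x ≤ 2 * w * s ^ 2 := by
      refine (sq_le_sq₀ hx.le (by positivity)).1 ?_
      have : (2 * w * s ^ 2) ^ 2 = 4 * A * s ^ 4 := by rw [← h7]; ring
      rw [this]
      have : 3 / 8 * s ^ 2 * s ^ 4 ≤ A * s ^ 4 := by gcongr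
      nlinarith
    have h10 : x ≤ 2 * w * z ^ 2 := by
      rw [h6]
      nlinarith [mul_pos h8 hA1]
    have h11 : x / z ≤ 2 * w * z := by
      rw [div_le_iff₀ h5]
      nlinarith
    have h12 : u x ^ 2 * (x / z) ≤ u x ^ 2 * (2 * w * z) := by gcongr
    have h13 : 2 * (u x * v x) * z ≤ 2 * (-(w * u x ^ 2)) * z := by gcongr
    nlinarith

lemma L23 {s q M : ℝ} {u v : ℝ → ℝ} (S : LSys s q M u v) (t : ℝ) (ht0 : 1 / s ^ 3 ≤ t)
    (ht2 : t ^ 2 ≤ 3 / 2 * s ^ 6) :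
    u t ^ 2 * Real.sqrt (s ^ 2 + |s ^ 6 - t ^ 2|) ≤
      288 * M * Real.exp (6 + 2 * |q|) := by
  have hs1 := S.hs
  have hs6 := S.hs6
  have hM := S.hM
  have hs : 0 < s := by linarith
  have hs2 : 1 ≤ s ^ 2 := one_le_pow₀ hs1
  have hs26 : s ^ 2 ≤ s ^ 6 := pow_le_pow_right₀ hs1 (by norm_num)
  have ht : 0 < t := lt_of_lt_of_le (by positivity) ht0
  set B := 9 * M * Real.exp (4 + |q|) with hBdef
  have hB : 0 ≤ B := by positivity
  have hE : 1 ≤ Real.exp (2 + |q|) := Real.one_le_exp (by positivity)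
  have hC : 288 * M * Real.exp (6 + 2 * |q|) = 32 * (B * Real.exp (2 + |q|)) := by
    rw [hBdef, mul_assoc (9 * M), ← Real.exp_add]
    ring_nf
  rw [hC]
  have hBE : B ≤ B * Real.exp (2 + |q|) := le_mul_of_one_le_right hB hE
  rcases le_total (t ^ 2) (s ^ 6 - s ^ 2 / 2) with h1 | h1
  · have h2 := L1 S t ht0 h1
    unfold LH at h2
    have hp : 0 < s ^ 6 - t ^ 2 := by nlinarith
    have hz := Real.sqrt_pos.2 hp
    rw [abs_of_pos hp]
    have h3 : Real.sqrt (s ^ 2 + (s ^ 6 - t ^ 2)) ≤ 2 * Real.sqrt (s ^ 6 - t ^ 2) := by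
      refine Real.sqrt_le_iff.2 ⟨by positivity, ?_⟩
      rw [mul_pow, Real.sq_sqrt hp.le]
      linarith
    set z := Real.sqrt (s ^ 6 - t ^ 2)
    have h4 : 0 ≤ (v t - t / (2 * z ^ 2) * u t) ^ 2 / z := by positivity
    calc _ ≤ u t ^ 2 * (2 * z) := by gcongr
      _ ≤ 2 * B := by nlinarith
      _ ≤ _ := by linarith
  have hp : 0 < s ^ 6 - s ^ 2 / 2 := by nlinarith
  have hmid : ∀ x, 0 < x → s ^ 6 - s ^ 2 / 2 ≤ x ^ 2 → x ^ 2 ≤ s ^ 6 + s ^ 2 / 2 →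
      u x ^ 2 ≤ 8 * B * Real.exp (2 + |q|) / s := by
    apply L2 S B
    apply L1 S
    · apply Real.le_sqrt_of_sq_le
      rw [div_pow, one_pow, div_le_iff₀ (by positivity)]
      have h3 : s ^ 6 / 2 ≤ s ^ 6 - s ^ 2 / 2 := by linarith
      have h4 : (s ^ 3) ^ 2 = s ^ 6 := by ring
      rw [h4]
      nlinarith
    · rw [Real.sq_sqrt hp.le]
  rcases le_total (t ^ 2) (s ^ 6 + s ^ 2 / 2) with h2 | h2
  · have h3 := hmid t ht h1 h2
    have h4 : Real.sqrt (s ^ 2 + |s ^ 6 - t ^ 2|) ≤ 2 * s := by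
      refine Real.sqrt_le_iff.2 ⟨by positivity, ?_⟩
      have : |s ^ 6 - t ^ 2| ≤ s ^ 2 / 2 := by
        rw [abs_le]; constructor <;> linarith
      nlinarith
    calc _ ≤ 8 * B * Real.exp (2 + |q|) / s * (2 * s) := by gcongr
      _ = 16 * (B * Real.exp (2 + |q|)) := by field_simp; ring
      _ ≤ _ := by nlinarith
  · have hb2 : Real.sqrt (s ^ 6 + s ^ 2 / 2) ^ 2 = s ^ 6 + s ^ 2 / 2 :=
      Real.sq_sqrt (by positivity)
    have h3 := hmid (Real.sqrt (s ^ 6 + s ^ 2 / 2)) (Real.sqrt_pos.2 (by positivity))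
      (by rw [hb2]; linarith) (by rw [hb2])
    have h4 := L4 S _ h3 t ht h2 ht2
    have h5 : Real.sqrt (s ^ 2 + |s ^ 6 - t ^ 2|) ≤
        2 * Real.sqrt (t ^ 2 - s ^ 6 - 1 / 8 + s ^ 2) := by
      refine Real.sqrt_le_iff.2 ⟨by positivity, ?_⟩
      rw [mul_pow, Real.sq_sqrt (by nlinarith), abs_of_nonpos (by nlinarith)]
      nlinarith
    calc _ ≤ u t ^ 2 * (2 * Real.sqrt (t ^ 2 - s ^ 6 - 1 / 8 + s ^ 2)) := by gcongr
      _ ≤ _ := by nlinarith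

lemma L5 {s q M : ℝ} {u v : ℝ → ℝ} (S : LSys s q M u v) (t : ℝ) (ht0 : 0 < t)
    (ht2 : 3 / 2 * s ^ 6 ≤ t ^ 2) :
    u t ^ 2 ≤ 288 * M * Real.exp (6 + 2 * |q|) * Real.exp (-(t ^ 2 / 18)) := by
  have hs1 := S.hs
  have hs6 := S.hs6
  have hM := S.hM
  have hs : 0 < s := by linarith
  have hs2 : 1 ≤ s ^ 2 := one_le_pow₀ hs1
  set C := 288 * M * Real.exp (6 + 2 * |q|)
  set b := Real.sqrt (5 / 4 * s ^ 6) with hb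
  have hb0 : 0 < b := Real.sqrt_pos.2 (by positivity)
  have hb2 : b ^ 2 = 5 / 4 * s ^ 6 := Real.sq_sqrt (by positivity)
  have hbt : b ≤ t := by
    refine (sq_le_sq₀ hb0.le ht0.le).1 ?_
    linarith
  have hub : u b ^ 2 ≤ C := by
    have h1 := L23 S b (by
      apply Real.le_sqrt_of_sq_le
      rw [div_pow, one_pow, div_le_iff₀ (by positivity)]
      have h4 : (s ^ 3) ^ 2 = s ^ 6 := by ring
      rw [h4]
      nlinarith) (by rw [hb2]; nlinarith)
    have h2 : 1 ≤ Real.sqrt (s ^ 2 + |s ^ 6 - b ^ 2|) := by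
      apply Real.le_sqrt_of_sq_le
      have := abs_nonneg (s ^ 6 - b ^ 2)
      linarith
    exact le_trans (le_mul_of_one_le_right (by positivity) h2) h1
  have hmono := aux_anti (fun x => u x ^ 2 * Real.exp (x ^ 2 / 3))
    (fun x => (2 * (u x * v x) + u x ^ 2 * (2 * x / 3)) * Real.exp (x ^ 2 / 3)) b t hbt ?_ ?_
  · have e1 : u t ^ 2 = u t ^ 2 * Real.exp (t ^ 2 / 3) * Real.exp (-(t ^ 2 / 3)) := by
      rw [mul_assoc, ← Real.exp_add]; simp
    rw [e1]
    calc _ ≤ u b ^ 2 * Real.exp (b ^ 2 / 3) * Real.exp (-(t ^ 2 / 3)) := by gcongr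
      _ = u b ^ 2 * Real.exp (b ^ 2 / 3 - t ^ 2 / 3) := by
        rw [mul_assoc, ← Real.exp_add]; rfl
      _ ≤ C * Real.exp (-(t ^ 2 / 18)) := by
        gcongr
        linarith
  · intro x h1 h2
    have hx : 0 < x := by linarith
    have d := (((hasDerivAt_id x).pow 2).div_const 3).exp
    refine (((S.du x hx).pow 2).mul d).congr_deriv ?_
    simp only [Pi.pow_apply, id, Nat.add_one_sub_one, pow_one, Nat.cast_ofNat]
    ring
  · intro x h1 h2
    have hx : 0 < x := by linarith
    have hx2 : b ^ 2 ≤ x ^ 2 := by gcongr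
    have h3 := L3 S x hx (by nlinarith)
    have h4 : x / 3 ≤ Real.sqrt (x ^ 2 - s ^ 6 - 1 / 8) := by
      apply Real.le_sqrt_of_sq_le
      nlinarith
    have h5 : x / 3 * u x ^ 2 ≤ Real.sqrt (x ^ 2 - s ^ 6 - 1 / 8) * u x ^ 2 := by gcongr
    apply mul_nonpos_of_nonpos_of_nonneg _ (Real.exp_pos _).le
    nlinarith

/-- coefficients of the Laguerre polynomial of integer type -/
def lagc (k d j : ℕ) : ℝ := (-1) ^ j * ((k + d).choose (j + d) : ℝ) / (Nat.factorial j)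

def lagP (k d : ℕ) : Polynomial ℝ :=
  ∑ j ∈ Finset.range (k + 1), Polynomial.C (lagc k d j) * Polynomial.X ^ j

lemma laguerreL_eq (k d : ℕ) (t : ℝ) : laguerreL k d t = (lagP k d).eval t := by
  unfold laguerreL lagP
  rw [Polynomial.eval_finsetSum]
  apply Finset.sum_congr rfl
  intro j hj
  have hj' : j ≤ k := by simpa [Nat.lt_succ_iff] using hj
  have h1 : Real.Gamma ((k : ℝ) + d + 1) = (Nat.factorial (k + d) : ℝ) := by
    rw [← Real.Gamma_nat_eq_factorial]; push_cast; rfl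
  have h2 : Real.Gamma ((j : ℝ) + d + 1) = (Nat.factorial (j + d) : ℝ) := by
    rw [← Real.Gamma_nat_eq_factorial]; push_cast; rfl
  rw [h1, h2]
  simp only [Polynomial.eval_mul, Polynomial.eval_C, Polynomial.eval_pow, Polynomial.eval_X, lagc]
  rw [Nat.cast_choose ℝ (show j + d ≤ k + d by lia), show k + d - (j + d) = k - j by lia]
  rw [neg_pow t]
  ring

lemma lagc_rec (k d j : ℕ) :
    lagc k d (j + 1) * (j + 1) * (j + d + 1) = -((k : ℝ) - j) * lagc k d j := by
  have h := Nat.choose_succ_right_eq (k + d) (j + d)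
  have h' : ((k + d).choose (j + 1 + d) : ℝ) * (j + d + 1)
      = ((k + d).choose (j + d) : ℝ) * ((k : ℝ) - j) := by
    rw [show j + 1 + d = j + d + 1 by lia]
    rcases le_or_gt j k with hjk | hjk
    · have h2 : (((k + d).choose (j + d + 1) * (j + d + 1) : ℕ) : ℝ)
          = (((k + d).choose (j + d) * (k + d - (j + d)) : ℕ) : ℝ) := by rw [h]
      rw [show k + d - (j + d) = k - j by lia] at h2
      push_cast [Nat.cast_sub hjk] at h2
      linarith
    · rw [Nat.choose_eq_zero_of_lt (by lia), Nat.choose_eq_zero_of_lt (by lia)]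
      simp
  unfold lagc
  rw [Nat.factorial_succ]
  have hf : (Nat.factorial j : ℝ) ≠ 0 := by positivity
  push_cast
  field_simp
  rw [pow_succ]
  linear_combination (-(-1) ^ j) * h'

lemma lagP_coeff (k d m : ℕ) : (lagP k d).coeff m = lagc k d m := by
  unfold lagP
  simp only [Polynomial.finsetSum_coeff, Polynomial.coeff_C_mul_X_pow]
  rw [Finset.sum_ite_eq]
  split_ifs with h
  · rfl
  · have : k < m := by simpa [Nat.lt_succ_iff] using h
    unfold lagc
    rw [Nat.choose_eq_zero_of_lt (by lia)]
    simp

open Polynomial in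
lemma lagP_ode (k d : ℕ) :
    X * derivative (derivative (lagP k d)) + (C ((d : ℝ) + 1) - X) * derivative (lagP k d)
      + C (k : ℝ) * lagP k d = 0 := by
  ext m
  cases m with
  | zero =>
    have := lagc_rec k d 0
    simp [sub_mul, coeff_derivative, lagP_coeff] at this ⊢
    linarith
  | succ m =>
    have := lagc_rec k d (m + 1)
    simp only [sub_mul, coeff_add, coeff_sub, coeff_X_mul, coeff_C_mul, coeff_derivative,
      lagP_coeff, coeff_zero] at this ⊢
    push_cast at this ⊢
    linarith

lemma lagc_abs (k d j : ℕ) (N : ℝ) (hN : (k : ℝ) + d ≤ N) :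
    |lagc k d j| ≤ N ^ (j + d) / (Nat.factorial j) := by
  unfold lagc
  rw [abs_div, abs_mul, abs_pow, abs_neg, abs_one, one_pow, one_mul, Nat.abs_cast, Nat.abs_cast]
  gcongr
  have h : ((k + d).choose (j + d) : ℝ) ≤ ((k + d : ℕ) : ℝ) ^ (j + d) := by
    exact_mod_cast Nat.choose_le_pow (k + d) (j + d)
  refine h.trans ?_
  push_cast
  gcongr

lemma lagP_bound (k d : ℕ) (N x : ℝ) (hN : (k : ℝ) + d ≤ N) (hx : 0 ≤ x) (hNx : N * x ≤ 1) :
    |(lagP k d).eval x| ≤ N ^ d * Real.exp 1 := by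
  have hN0 : 0 ≤ N := le_trans (by positivity) hN
  unfold lagP
  rw [Polynomial.eval_finsetSum]
  calc _ ≤ ∑ j ∈ Finset.range (k + 1), N ^ d * ((N * x) ^ j / (Nat.factorial j)) := by
        refine (Finset.abs_sum_le_sum_abs _ _).trans (Finset.sum_le_sum ?_)
        intro j _
        simp only [Polynomial.eval_mul, Polynomial.eval_C, Polynomial.eval_pow, Polynomial.eval_X]
        rw [abs_mul, abs_of_nonneg (show 0 ≤ x ^ j by positivity)]
        calc _ ≤ N ^ (j + d) / (Nat.factorial j) * x ^ j := by
              gcongr; exact lagc_abs k d j N hN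
          _ = _ := by rw [mul_pow, pow_add]; ring
    _ = N ^ d * ∑ j ∈ Finset.range (k + 1), (N * x) ^ j / (Nat.factorial j) := by
        rw [Finset.mul_sum]
    _ ≤ N ^ d * Real.exp (N * x) := by
        gcongr
        exact Real.sum_le_exp_of_nonneg (by positivity) _
    _ ≤ _ := by gcongr

lemma lagP_bound' (k d : ℕ) (N x : ℝ) (hN : (k : ℝ) + d ≤ N) (hx : 0 ≤ x) (hNx : N * x ≤ 1) :
    |(Polynomial.derivative (lagP k d)).eval x| ≤ N ^ (d + 1) * Real.exp 1 := by
  have hN0 : 0 ≤ N := le_trans (by positivity) hN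
  have e : (Polynomial.derivative (lagP k d)).eval x
      = ∑ j ∈ Finset.range k, lagc k d (j + 1) * (j + 1) * x ^ j := by
    unfold lagP
    rw [Finset.sum_range_succ']
    simp [Polynomial.eval_finsetSum, mul_assoc]
  rw [e]
  calc _ ≤ ∑ j ∈ Finset.range k, N ^ (d + 1) * ((N * x) ^ j / (Nat.factorial j)) := by
        refine (Finset.abs_sum_le_sum_abs _ _).trans (Finset.sum_le_sum ?_)
        intro j _
        rw [abs_mul, abs_mul, abs_of_nonneg (show 0 ≤ x ^ j by positivity),
          abs_of_nonneg (show 0 ≤ (j : ℝ) + 1 by positivity)]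
        calc _ ≤ N ^ (j + 1 + d) / (Nat.factorial (j + 1)) * (j + 1) * x ^ j := by
              gcongr; exact lagc_abs k d (j + 1) N hN
          _ = _ := by
            have hf : (Nat.factorial j : ℝ) ≠ 0 := by positivity
            rw [Nat.factorial_succ]
            push_cast
            field_simp
            ring
    _ = N ^ (d + 1) * ∑ j ∈ Finset.range k, (N * x) ^ j / (Nat.factorial j) := by
        rw [Finset.mul_sum]
    _ ≤ N ^ (d + 1) * Real.exp (N * x) := by
        gcongr
        exact Real.sum_le_exp_of_nonneg (by positivity) _
    _ ≤ _ := by gcongr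

lemma Ckn_sq (k d : ℕ) :
    Ckn (d + 1) k ^ 2 * nuk (d + 1) k ^ d ≤ (Nat.factorial d : ℝ) * (2 * d + 4) ^ d := by
  unfold Ckn
  rw [Real.sq_sqrt (by positivity)]
  have h1 : nuk (d + 1) k ^ d ≤ ((2 * d + 4) * (k + 1)) ^ d := by
    have hb : nuk (d + 1) k ≤ (2 * d + 4) * (k + 1) := by
      unfold nuk
      push_cast
      nlinarith [show (0 : ℝ) ≤ d * k by positivity]
    have hb0 : 0 ≤ nuk (d + 1) k := by unfold nuk; positivity
    gcongr
  have h2 : (Nat.factorial k : ℝ) * (k + 1) ^ d ≤ (Nat.factorial (k + d)) := by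
    exact_mod_cast Nat.factorial_mul_pow_le_factorial (m := k) (n := d)
  rw [show k + (d + 1) - 1 = k + d by lia, show d + 1 - 1 = d by lia]
  rw [div_mul_eq_mul_div, div_le_iff₀ (by positivity)]
  calc _ ≤ (Nat.factorial k : ℝ) * (Nat.factorial d) * ((2 * d + 4) * (k + 1)) ^ d := by gcongr
    _ = (Nat.factorial d : ℝ) * (2 * d + 4) ^ d * ((Nat.factorial k : ℝ) * (k + 1) ^ d) := by
      rw [mul_pow]; ring
    _ ≤ _ := by gcongr

def lw (d : ℕ) (t : ℝ) : ℝ := t ^ ((d : ℝ) + 1 / 2) * Real.exp (-(t ^ 2 / 2))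

lemma lw_deriv (d : ℕ) (t : ℝ) (ht : 0 < t) :
    HasDerivAt (lw d) (lw d t * (((d : ℝ) + 1 / 2) / t - t)) t := by
  have h1 := Real.hasDerivAt_rpow_const (x := t) (p := (d : ℝ) + 1 / 2) (Or.inl ht.ne')
  have h2 := (((hasDerivAt_id t).pow 2).div_const 2).neg.exp
  refine (h1.mul h2).congr_deriv ?_
  rw [Real.rpow_sub_one ht.ne']
  simp only [lw, Pi.pow_apply, Pi.neg_apply, id, Nat.add_one_sub_one, pow_one, Nat.cast_ofNat]
  field_simp
  ring

lemma lw_tendsto (d : ℕ) (q : Polynomial ℝ) :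
    Tendsto (fun t => lw d t * q.eval t) atTop (nhds 0) := by
  have h := (Polynomial.tendsto_div_exp_atTop (Polynomial.X ^ (d + 1) * q)).norm
  rw [norm_zero] at h
  refine squeeze_zero_norm' ?_ h
  filter_upwards [eventually_ge_atTop 2] with t ht
  have ht0 : 0 < t := by linarith
  have h1 : t ^ ((d : ℝ) + 1 / 2) ≤ t ^ (d + 1) := by
    rw [← Real.rpow_natCast]
    apply Real.rpow_le_rpow_of_exponent_le (by linarith)
    push_cast
    linarith
  have h2 : Real.exp (-(t ^ 2 / 2)) ≤ (Real.exp t)⁻¹ := by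
    rw [← Real.exp_neg, Real.exp_le_exp]
    nlinarith
  simp only [Polynomial.eval_mul, Polynomial.eval_pow, Polynomial.eval_X, Real.norm_eq_abs]
  rw [abs_mul, abs_div, abs_mul, abs_of_nonneg (show 0 ≤ lw d t by unfold lw; positivity),
    abs_of_nonneg (Real.exp_pos t).le, abs_of_nonneg (show 0 ≤ t ^ (d + 1) by positivity)]
  calc lw d t * |q.eval t| ≤ t ^ (d + 1) * (Real.exp t)⁻¹ * |q.eval t| := by
        unfold lw
        gcongr
    _ = _ := by ring

def lu (k d : ℕ) (t : ℝ) : ℝ := Ckn (d + 1) k * (lw d t * (lagP k d).eval (t ^ 2))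
def lv (k d : ℕ) (t : ℝ) : ℝ := Ckn (d + 1) k * (lw d t *
  ((((d : ℝ) + 1 / 2) / t - t) * (lagP k d).eval (t ^ 2)
    + 2 * t * (Polynomial.derivative (lagP k d)).eval (t ^ 2)))

def lM (d : ℕ) : ℝ :=
  (Nat.factorial d : ℝ) * (2 * d + 4) ^ d * (Real.exp 1 ^ 2 * ((d : ℝ) + 4) ^ 2)

lemma evalsq_deriv (p : Polynomial ℝ) (t : ℝ) :
    HasDerivAt (fun x => p.eval (x ^ 2)) (2 * t * (Polynomial.derivative p).eval (t ^ 2)) t := by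
  have h := (p.hasDerivAt (t ^ 2)).comp t ((hasDerivAt_id t).pow 2)
  refine h.congr_deriv ?_
  simp
  ring

lemma lw_init (d : ℕ) (s : ℝ) (hs : 1 ≤ s) : lw d (1 / s ^ 3) ^ 2 ≤ 1 / s ^ (6 * d + 3) := by
  have h0 : 0 < 1 / s ^ 3 := by positivity
  unfold lw
  rw [mul_pow, ← Real.rpow_natCast (_ ^ _), ← Real.rpow_mul h0.le]
  have e : ((d : ℝ) + 1 / 2) * ((2 : ℕ) : ℝ) = ((2 * d + 1 : ℕ) : ℝ) := by push_cast; ring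
  rw [e, Real.rpow_natCast, div_pow, one_pow, ← pow_mul, show 3 * (2 * d + 1) = 6 * d + 3 by ring]
  have h1 : Real.exp (-((1 / s ^ 3) ^ 2 / 2)) ^ 2 ≤ 1 := by
    apply pow_le_one₀ (Real.exp_pos _).le
    rw [Real.exp_le_one_iff]
    have : 0 ≤ (1 / s ^ 3) ^ 2 / 2 := by positivity
    linarith
  exact mul_le_of_le_one_right (by positivity) h1

lemma lsys (k d : ℕ) (s : ℝ) (hs : 1 ≤ s) (hs6 : s ^ 6 = nuk (d + 1) k) :
    LSys s ((d : ℝ) ^ 2 - 1 / 4) (lM d) (lu k d) (lv k d) := by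
  have hnu : nuk (d + 1) k = 4 * k + 2 * d + 2 := by unfold nuk; push_cast; ring
  have hd0 : (0 : ℝ) ≤ d := by positivity
  have hk0 : (0 : ℝ) ≤ k := by positivity
  have hs0 : 0 < s := by linarith
  have hC := Ckn_sq k d
  rw [← hs6] at hC
  have hkd : (k : ℝ) + d ≤ s ^ 6 := by rw [hs6, hnu]; linarith
  have ht1 : s ^ 6 * (1 / s ^ 3) ^ 2 ≤ 1 := by
    apply le_of_eq; field_simp
  have b0 := lagP_bound k d (s ^ 6) ((1 / s ^ 3) ^ 2) hkd (by positivity) ht1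
  have b1 := lagP_bound' k d (s ^ 6) ((1 / s ^ 3) ^ 2) hkd (by positivity) ht1
  have bw := lw_init d s hs
  have hs3 : 1 ≤ s ^ 3 := one_le_pow₀ hs
  -- combined estimate
  have key : ∀ Z W : ℝ, 0 ≤ W → |Z| ≤ (s ^ 6) ^ d * W →
      (Ckn (d + 1) k * (lw d (1 / s ^ 3) * Z)) ^ 2 ≤
        (Nat.factorial d : ℝ) * (2 * d + 4) ^ d * W ^ 2 / s ^ 3 := by
    intro Z W hW hZ
    have hZ2 : Z ^ 2 ≤ ((s ^ 6) ^ d * W) ^ 2 := by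
      rw [← sq_abs Z]; gcongr
    calc _ = Ckn (d + 1) k ^ 2 * (lw d (1 / s ^ 3) ^ 2 * Z ^ 2) := by ring
      _ ≤ Ckn (d + 1) k ^ 2 * (1 / s ^ (6 * d + 3) * ((s ^ 6) ^ d * W) ^ 2) := by gcongr
      _ = (Ckn (d + 1) k ^ 2 * (s ^ 6) ^ d) * W ^ 2 / s ^ 3 := by
        rw [pow_add, pow_mul]; field_simp
      _ ≤ _ := by gcongr
  constructor
  · exact hs
  · rw [hs6, hnu]; linarith
  · nlinarith [sq_nonneg (d : ℝ)]
  · unfold lM; positivity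
  · intro t ht
    refine (((lw_deriv d t ht).mul (evalsq_deriv (lagP k d) t)).const_mul _).congr_deriv ?_
    unfold lv
    ring
  · intro t ht
    have dl := lw_deriv d t ht
    have e0 := evalsq_deriv (lagP k d) t
    have e1 := evalsq_deriv (Polynomial.derivative (lagP k d)) t
    have da := ((hasDerivAt_const t ((d : ℝ) + 1 / 2)).div (hasDerivAt_id t) ht.ne').sub
      (hasDerivAt_id t)
    have := (dl.mul ((da.mul e0).add (((hasDerivAt_id t).const_mul 2).mul e1))).const_mul
      (Ckn (d + 1) k)
    refine this.congr_deriv ?_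
    have ode := congrArg (Polynomial.eval (t ^ 2)) (lagP_ode k d)
    simp only [Polynomial.eval_add, Polynomial.eval_sub, Polynomial.eval_mul, Polynomial.eval_X,
      Polynomial.eval_C, Polynomial.eval_zero] at ode
    rw [hs6, hnu]
    simp only [lu, Pi.mul_apply, Pi.add_apply, Pi.sub_apply, Pi.div_apply, id]
    generalize (lagP k d).eval (t ^ 2) = A0 at *
    generalize (Polynomial.derivative (lagP k d)).eval (t ^ 2) = A1 at *
    generalize (Polynomial.derivative (Polynomial.derivative (lagP k d))).eval (t ^ 2) = A2 at *
    generalize lw d t = W at *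
    generalize Ckn (d + 1) k = c at *
    field_simp
    linear_combination (64 * c * W * t ^ 2) * ode
  · have := key _ (Real.exp 1) (by positivity) b0
    refine this.trans ?_
    unfold lM
    gcongr
    apply le_mul_of_one_le_right (by positivity)
    nlinarith
  · have hZ : |(((d : ℝ) + 1 / 2) / (1 / s ^ 3) - 1 / s ^ 3) * (lagP k d).eval ((1 / s ^ 3) ^ 2)
        + 2 * (1 / s ^ 3) * (Polynomial.derivative (lagP k d)).eval ((1 / s ^ 3) ^ 2)| ≤
        (s ^ 6) ^ d * (s ^ 3 * (Real.exp 1 * ((d : ℝ) + 4))) := by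
      have a1 : |((d : ℝ) + 1 / 2) / (1 / s ^ 3) - 1 / s ^ 3| ≤ ((d : ℝ) + 3 / 2) * s ^ 3 := by
        have i1 : 1 / s ^ 3 ≤ 1 := by rw [div_le_one (by positivity)]; exact hs3
        have i2 : 0 < 1 / s ^ 3 := by positivity
        rw [div_div_eq_mul_div, div_one, abs_le]
        constructor <;> nlinarith
      refine (abs_add_le _ _).trans ?_
      rw [abs_mul, abs_mul, abs_of_pos (show 0 < 2 * (1 / s ^ 3) by positivity)]
      calc _ ≤ ((d : ℝ) + 3 / 2) * s ^ 3 * ((s ^ 6) ^ d * Real.exp 1)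
            + 2 * (1 / s ^ 3) * ((s ^ 6) ^ (d + 1) * Real.exp 1) := by gcongr
        _ = (s ^ 6) ^ d * (s ^ 3 * (Real.exp 1 * ((d : ℝ) + 7 / 2))) := by
          rw [pow_succ (s ^ 6) d]; field_simp; ring
        _ ≤ _ := by gcongr; norm_num
    have := key _ _ (by positivity) hZ
    refine this.trans (le_of_eq ?_)
    unfold lM
    field_simp
  · have := (lw_tendsto d (Polynomial.X * (lagP k d).comp (Polynomial.X ^ 2))).const_mul
      (Ckn (d + 1) k)
    rw [mul_zero] at this
    refine this.congr ?_
    intro t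
    simp [lu]
    ring
  · have l1 := (lw_tendsto d (Polynomial.X * (lagP k d).comp (Polynomial.X ^ 2)))
    have l2 := (lw_tendsto d ((lagP k d).comp (Polynomial.X ^ 2)))
    have l3 := (lw_tendsto d (Polynomial.X *
      (Polynomial.derivative (lagP k d)).comp (Polynomial.X ^ 2)))
    have l4 := ((tendsto_inv_atTop_zero (𝕜 := ℝ)).const_mul ((d : ℝ) + 1 / 2)).mul l2
    have := ((l4.sub l1).add (l3.const_mul 2)).const_mul (Ckn (d + 1) k)
    norm_num at this
    refine this.congr ?_
    intro t
    simp only [lv, Polynomial.eval_comp, Polynomial.eval_mul, Polynomial.eval_pow,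
      Polynomial.eval_X]
    ring

def lK (d : ℕ) : ℝ := 288 * lM d * Real.exp (6 + 2 * |(d : ℝ) ^ 2 - 1 / 4|)

def lA (d : ℕ) : ℝ := (Nat.factorial d : ℝ) * (2 * d + 4) ^ d

lemma lK_pos (d : ℕ) : 0 < lK d := by unfold lK lM; positivity

lemma nuk_ge (d k : ℕ) : 2 ≤ nuk (d + 1) k := by
  unfold nuk
  push_cast
  nlinarith [show (0 : ℝ) ≤ d by positivity, show (0 : ℝ) ≤ k by positivity]

lemma lsys_nu (k d : ℕ) : LSys (nuk (d + 1) k ^ ((1 : ℝ) / 6)) ((d : ℝ) ^ 2 - 1 / 4) (lM d)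
    (lu k d) (lv k d) ∧ (nuk (d + 1) k ^ ((1 : ℝ) / 6)) ^ 6 = nuk (d + 1) k ∧
    (nuk (d + 1) k ^ ((1 : ℝ) / 6)) ^ 2 = nuk (d + 1) k ^ ((1 : ℝ) / 3) := by
  have h := nuk_ge d k
  have h6 : (nuk (d + 1) k ^ ((1 : ℝ) / 6)) ^ 6 = nuk (d + 1) k := by
    rw [← Real.rpow_natCast, ← Real.rpow_mul (by linarith)]
    norm_num
  refine ⟨lsys k d _ (Real.one_le_rpow (by linarith) (by norm_num)) h6, h6, ?_⟩
  rw [← Real.rpow_natCast, ← Real.rpow_mul (by linarith)]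
  norm_num

lemma bound23 (k d : ℕ) (x : ℝ) (hx : 0 < x) (h1 : 1 ≤ nuk (d + 1) k * x)
    (h2 : x ≤ 3 / 2 * nuk (d + 1) k) :
    |lu k d (Real.sqrt x)| ≤ Real.sqrt (lK d) *
      (nuk (d + 1) k ^ ((1 : ℝ) / 3) + |nuk (d + 1) k - x|) ^ (-(1 : ℝ) / 4) := by
  obtain ⟨S, h6, h3⟩ := lsys_nu k d
  have hsx : Real.sqrt x ^ 2 = x := Real.sq_sqrt hx.le
  have hnu := nuk_ge d k
  have hs := S.hs
  have h := L23 S (Real.sqrt x) (by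
    apply Real.le_sqrt_of_sq_le
    rw [div_pow, one_pow, ← pow_mul, h6, div_le_iff₀ (by linarith)]
    linarith) (by rw [hsx, h6]; exact h2)
  rw [hsx, h6, h3] at h
  set Y := nuk (d + 1) k ^ ((1 : ℝ) / 3) + |nuk (d + 1) k - x| with hY
  have hY0 : 0 < Y := by positivity
  refine abs_le_of_sq_le_sq' ?_ (by positivity) |> abs_le.2
  have e : (Y ^ (-(1 : ℝ) / 4)) ^ 2 = (Real.sqrt Y)⁻¹ := by
    rw [← Real.rpow_natCast, ← Real.rpow_mul hY0.le, Real.sqrt_eq_rpow, ← Real.rpow_neg hY0.le]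
    norm_num
  rw [mul_pow, Real.sq_sqrt (lK_pos d).le, e, ← div_eq_mul_inv, le_div_iff₀ (by positivity)]
  exact h

lemma bound4 (k d : ℕ) (x : ℝ) (hx : 0 < x) (h2 : 3 / 2 * nuk (d + 1) k ≤ x) :
    |lu k d (Real.sqrt x)| ≤ Real.sqrt (lK d) * Real.exp (-(x / 36)) := by
  obtain ⟨S, h6, h3⟩ := lsys_nu k d
  have hsx : Real.sqrt x ^ 2 = x := Real.sq_sqrt hx.le
  have h := L5 S (Real.sqrt x) (Real.sqrt_pos.2 hx) (by rw [hsx, h6]; exact h2)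
  rw [hsx] at h
  refine abs_le_of_sq_le_sq' ?_ (by positivity) |> abs_le.2
  rw [mul_pow, Real.sq_sqrt (lK_pos d).le, ← Real.exp_nat_mul]
  refine h.trans (le_of_eq ?_)
  unfold lK
  congr 2
  push_cast
  ring

def lF (k d : ℕ) (x : ℝ) : ℝ :=
  Ckn (d + 1) k * |(lagP k d).eval x * Real.exp (-(x / 2))|

lemma lF_eq (k d : ℕ) (x : ℝ) (hx : 0 < x) :
    lF k d x = x ^ (-(d : ℝ) / 2) * x ^ (-(1 : ℝ) / 4) * |lu k d (Real.sqrt x)| := by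
  have hC : 0 ≤ Ckn (d + 1) k := Real.sqrt_nonneg _
  unfold lF lu lw
  rw [Real.sq_sqrt hx.le, Real.sqrt_eq_rpow, ← Real.rpow_mul hx.le]
  simp only [abs_mul]
  rw [abs_of_nonneg hC, abs_of_pos (Real.exp_pos _), abs_of_pos (Real.rpow_pos_of_pos hx _)]
  have : x ^ (-(d : ℝ) / 2) * x ^ (-(1 : ℝ) / 4) * x ^ ((1 : ℝ) / 2 * ((d : ℝ) + 1 / 2)) = 1 := by
    rw [← Real.rpow_add hx, ← Real.rpow_add hx,
      show (-(d : ℝ) / 2 + -(1 : ℝ) / 4 + (1 : ℝ) / 2 * ((d : ℝ) + 1 / 2)) = 0 by ring,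
      Real.rpow_zero]
  linear_combination (-(Ckn (d + 1) k * |(lagP k d).eval x| * Real.exp (-(x / 2)))) * this

lemma bound1 (k d : ℕ) (x : ℝ) (hx : 0 < x) (h1 : nuk (d + 1) k * x ≤ 1) :
    lF k d x ≤ Real.sqrt (lA d) * Real.exp 1 * nuk (d + 1) k ^ ((d : ℝ) / 2) := by
  have hnu := nuk_ge d k
  have hnu0 : 0 < nuk (d + 1) k := by linarith
  have hC : 0 ≤ Ckn (d + 1) k := Real.sqrt_nonneg _
  have hb := lagP_bound k d (nuk (d + 1) k) x (by
    unfold nuk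
    push_cast
    linarith [show (0 : ℝ) ≤ d by positivity, show (0 : ℝ) ≤ k by positivity]) hx.le h1
  have hsq := Ckn_sq k d
  set N := nuk (d + 1) k
  have hN2 : (N ^ ((d : ℝ) / 2)) ^ 2 = N ^ d := by
    rw [← Real.rpow_natCast, ← Real.rpow_mul hnu0.le, ← Real.rpow_natCast]
    congr 1
    push_cast
    ring
  have hc : Ckn (d + 1) k * N ^ ((d : ℝ) / 2) ≤ Real.sqrt (lA d) := by
    apply Real.le_sqrt_of_sq_le
    rw [mul_pow, hN2]
    exact hsq
  have he : Real.exp (-(x / 2)) ≤ 1 := by rw [Real.exp_le_one_iff]; linarith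
  unfold lF
  rw [abs_mul, abs_of_pos (Real.exp_pos _)]
  calc _ ≤ Ckn (d + 1) k * (N ^ d * Real.exp 1 * 1) := by gcongr
    _ = (Ckn (d + 1) k * N ^ ((d : ℝ) / 2)) * Real.exp 1 * N ^ ((d : ℝ) / 2) := by
      rw [← hN2]; ring
    _ ≤ _ := by gcongr

lemma quarter (N y : ℝ) (hN : 0 < N) (hy : N / 2 ≤ y) :
    y ^ (-(1 : ℝ) / 4) ≤ 2 * N ^ (-(1 : ℝ) / 4) := by
  calc y ^ (-(1 : ℝ) / 4) ≤ (N / 2) ^ (-(1 : ℝ) / 4) :=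
        Real.rpow_le_rpow_of_nonpos (by positivity) hy (by norm_num)
    _ = (2 : ℝ) ^ ((1 : ℝ) / 4) * N ^ (-(1 : ℝ) / 4) := by
        rw [Real.div_rpow hN.le (by norm_num), div_eq_mul_inv, ← Real.rpow_neg (by norm_num)]
        rw [mul_comm]
        norm_num
    _ ≤ (2 : ℝ) ^ (1 : ℝ) * N ^ (-(1 : ℝ) / 4) := by
        gcongr
        · norm_num
        · norm_num
    _ = _ := by rw [Real.rpow_one]

/-- **Sharp Laguerre function estimates.** There are constants `C, γ > 0` depending only
on `n` such that for all `k ≥ 0`, `λ ≠ 0`, `r > 0`,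
`C_{k,n} |φ_{k,λ}^{n-1}(r)| ≤ C (r√|λ|)^{-(n-1)} E` with `E` as in the four ranges. -/
theorem laguerre_sharp_estimates (n : ℕ) (hn : 1 ≤ n) :
    ∃ C > (0 : ℝ), ∃ γ > (0 : ℝ), ∀ (k : ℕ) (lam r : ℝ), lam ≠ 0 → 0 < r →
      (r ≤ Real.sqrt 2 / Real.sqrt (nuk n k * |lam|) →
        Ckn n k * |lagPhi n k lam r| ≤
          C * (r * Real.sqrt |lam|) ^ (-((n : ℝ) - 1)) *
            ((1/2) * nuk n k * r ^ 2 * |lam|) ^ (((n : ℝ) - 1) / 2)) ∧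
      (Real.sqrt 2 / Real.sqrt (nuk n k * |lam|) ≤ r →
        r ≤ Real.sqrt (nuk n k) / Real.sqrt |lam| →
        Ckn n k * |lagPhi n k lam r| ≤
          C * (r * Real.sqrt |lam|) ^ (-((n : ℝ) - 1)) *
            ((1/2) * nuk n k * r ^ 2 * |lam|) ^ (-(1 : ℝ) / 4)) ∧
      (Real.sqrt (nuk n k) / Real.sqrt |lam| ≤ r →
        r ≤ Real.sqrt (3 * nuk n k) / Real.sqrt |lam| →
        Ckn n k * |lagPhi n k lam r| ≤
          C * (r * Real.sqrt |lam|) ^ (-((n : ℝ) - 1)) *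
            (nuk n k ^ (-(1 : ℝ) / 4) *
              (nuk n k ^ ((1 : ℝ) / 3) + |nuk n k - (1/2) * |lam| * r ^ 2|) ^ (-(1 : ℝ) / 4))) ∧
      (Real.sqrt (3 * nuk n k) / Real.sqrt |lam| ≤ r →
        Ckn n k * |lagPhi n k lam r| ≤
          C * (r * Real.sqrt |lam|) ^ (-((n : ℝ) - 1)) *
            Real.exp (-(1/2) * γ * r ^ 2 * |lam|)) := by
  obtain ⟨d, rfl⟩ : ∃ d, n = d + 1 := ⟨n - 1, by lia⟩
  have hcast : (((d + 1 : ℕ) : ℝ) - 1) = (d : ℝ) := by push_cast; ring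
  rw [hcast]
  have hK := lK_pos d
  have hA : 0 < lA d := by unfold lA; positivity
  set T : ℝ := (2 : ℝ) ^ ((d : ℝ) / 2) with hT
  have hT0 : 0 < T := by positivity
  set C1 := 2 * Real.sqrt (lK d) + Real.sqrt (lA d) * Real.exp 1 with hC1
  have hC1a : 2 * Real.sqrt (lK d) ≤ C1 := by
    have : 0 ≤ Real.sqrt (lA d) * Real.exp 1 := by positivity
    linarith
  have hC1b : Real.sqrt (lA d) * Real.exp 1 ≤ C1 := by
    have : 0 ≤ 2 * Real.sqrt (lK d) := by positivity
    linarith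
  have hC10 : 0 < C1 := lt_of_lt_of_le (by positivity) hC1a
  refine ⟨T * C1, by positivity, 1 / 36, by norm_num, ?_⟩
  intro k lam r hlam hr
  have hl : 0 < |lam| := abs_pos.2 hlam
  have hnu := nuk_ge d k
  set N := nuk (d + 1) k with hN
  have hN0 : 0 < N := by linarith
  set x := 1 / 2 * |lam| * r ^ 2 with hx
  have hx0 : 0 < x := by positivity
  have hF : Ckn (d + 1) k * |lagPhi (d + 1) k lam r| = lF k d x := by
    unfold lagPhi lF
    rw [hcast, laguerreL_eq, ← hx, show -(1 / 4) * |lam| * r ^ 2 = -(x / 2) by rw [hx]; ring]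
  have hpre : (r * Real.sqrt |lam|) ^ (-(d : ℝ)) = T⁻¹ * x ^ (-(d : ℝ) / 2) := by
    have e : r * Real.sqrt |lam| = (2 * x) ^ ((1 : ℝ) / 2) := by
      rw [← Real.sqrt_eq_rpow, show 2 * x = r ^ 2 * |lam| by rw [hx]; ring,
        Real.sqrt_mul (by positivity), Real.sqrt_sq hr.le]
    rw [e, ← Real.rpow_mul (by positivity), Real.mul_rpow (by norm_num) hx0.le, hT,
      ← Real.rpow_neg (by norm_num)]
    congr 2 <;> ring
  have hNx : 1 / 2 * N * r ^ 2 * |lam| = N * x := by rw [hx]; ring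
  have hTC : ∀ E, T * C1 * (T⁻¹ * x ^ (-(d : ℝ) / 2)) * E = x ^ (-(d : ℝ) / 2) * (C1 * E) := by
    intro E
    field_simp
  have hrs : (r * Real.sqrt |lam|) ^ 2 = 2 * x := by
    rw [mul_pow, Real.sq_sqrt hl.le, hx]; ring
  rw [hF, hpre, hNx, hTC, hTC, hTC, hTC]
  have hrl0 : 0 < r * Real.sqrt |lam| := by positivity
  have hxd : 0 < x ^ (-(d : ℝ) / 2) := Real.rpow_pos_of_pos hx0 _
  have hsplit : Real.sqrt (N * |lam|) = Real.sqrt N * Real.sqrt |lam| :=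
    Real.sqrt_mul hN0.le _
  have hrsN : (r * (Real.sqrt N * Real.sqrt |lam|)) ^ 2 = 2 * (N * x) := by
    rw [show r * (Real.sqrt N * Real.sqrt |lam|) = Real.sqrt N * (r * Real.sqrt |lam|) by ring,
      mul_pow, hrs, Real.sq_sqrt hN0.le]
    ring
  rw [hsplit]
  refine ⟨?_, ?_, ?_, ?_⟩
  · intro h
    rw [le_div_iff₀ (by positivity)] at h
    have h1 : N * x ≤ 1 := by
      have := pow_le_pow_left₀ (by positivity) h 2
      rw [hrsN, Real.sq_sqrt (by norm_num)] at this
      linarith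
    have hb := bound1 k d x hx0 h1
    have e : x ^ (-(d : ℝ) / 2) * (C1 * (N * x) ^ ((d : ℝ) / 2)) = C1 * N ^ ((d : ℝ) / 2) := by
      rw [Real.mul_rpow hN0.le hx0.le, neg_div, Real.rpow_neg hx0.le]
      field_simp
    rw [e]
    refine hb.trans ?_
    gcongr
  · intro h h'
    rw [div_le_iff₀ (by positivity)] at h
    rw [le_div_iff₀ (by positivity)] at h'
    have h1 : 1 ≤ N * x := by
      have := pow_le_pow_left₀ (by positivity) h 2
      rw [hrsN, Real.sq_sqrt (by norm_num)] at this
      linarith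
    have h2 : x ≤ N / 2 := by
      have := pow_le_pow_left₀ (by positivity) h' 2
      rw [hrs, Real.sq_sqrt hN0.le] at this
      linarith
    have hb := bound23 k d x hx0 h1 (by linarith)
    rw [← hN] at hb
    rw [lF_eq k d x hx0, Real.mul_rpow hN0.le hx0.le, mul_assoc]
    have hq := quarter N (N ^ ((1 : ℝ) / 3) + |N - x|) hN0 (by
      have := le_abs_self (N - x)
      have : 0 ≤ N ^ ((1 : ℝ) / 3) := by positivity
      linarith)
    refine mul_le_mul_of_nonneg_left ?_ hxd.le
    calc _ ≤ x ^ (-(1 : ℝ) / 4) * (Real.sqrt (lK d) * (2 * N ^ (-(1 : ℝ) / 4))) := by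
          gcongr
          exact hb.trans (by gcongr)
      _ = 2 * Real.sqrt (lK d) * (N ^ (-(1 : ℝ) / 4) * x ^ (-(1 : ℝ) / 4)) := by ring
      _ ≤ _ := by gcongr
  · intro h h'
    rw [div_le_iff₀ (by positivity)] at h
    rw [le_div_iff₀ (by positivity)] at h'
    have h1 : N / 2 ≤ x := by
      have := pow_le_pow_left₀ (by positivity) h 2
      rw [hrs, Real.sq_sqrt hN0.le] at this
      linarith
    have h2 : x ≤ 3 / 2 * N := by
      have := pow_le_pow_left₀ (by positivity) h' 2
      rw [hrs, Real.sq_sqrt (by positivity)] at this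
      linarith
    have hb := bound23 k d x hx0 (by nlinarith) h2
    rw [← hN] at hb
    rw [lF_eq k d x hx0, mul_assoc]
    have hq := quarter N x hN0 h1
    refine mul_le_mul_of_nonneg_left ?_ hxd.le
    calc _ ≤ (2 * N ^ (-(1 : ℝ) / 4)) * (Real.sqrt (lK d) *
          (N ^ ((1 : ℝ) / 3) + |N - x|) ^ (-(1 : ℝ) / 4)) := by
          gcongr
      _ = 2 * Real.sqrt (lK d) * (N ^ (-(1 : ℝ) / 4) *
          (N ^ ((1 : ℝ) / 3) + |N - x|) ^ (-(1 : ℝ) / 4)) := by ring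
      _ ≤ _ := by gcongr
  · intro h
    rw [div_le_iff₀ (by positivity)] at h
    have h2 : 3 / 2 * N ≤ x := by
      have := pow_le_pow_left₀ (by positivity) h 2
      rw [hrs, Real.sq_sqrt (by positivity)] at this
      linarith
    have hb := bound4 k d x hx0 h2
    rw [lF_eq k d x hx0, mul_assoc,
      show -(1 / 2) * (1 / 36) * r ^ 2 * |lam| = -(x / 36) by rw [hx]; ring]
    have hx1 : x ^ (-(1 : ℝ) / 4) ≤ 1 :=
      Real.rpow_le_one_of_one_le_of_nonpos (by linarith) (by norm_num)
    refine mul_le_mul_of_nonneg_left ?_ hxd.le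
    calc _ ≤ 1 * (Real.sqrt (lK d) * Real.exp (-(x / 36))) := by gcongr
      _ ≤ 2 * Real.sqrt (lK d) * Real.exp (-(x / 36)) := by
        have : 0 ≤ Real.sqrt (lK d) * Real.exp (-(x / 36)) := by positivity
        linarith
      _ ≤ _ := by gcongr
end
end
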